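/- arXiv:math/0610360 — 3 statements merged into one kernel-verified Lean document; each statement's English description precedes it below -/
import Mathlib

section
/- Let f be a nonnegative real-valued multiplicative arithmetic function. For each prime p define ρ(p) = sup_{ν ≥ 0} f(p^ν) and suppose ρ(p) < ∞ for all p. If the product R = ∏_p (1 - 1/p)·ρ(p) converges unconditionally (improper limits allowed), then limsup_{n→∞} f(n)/log log n ≤ e^γ · R, where γ is the Euler–Mascheroni constant. -/
open Filter Real
open scoped ENNReal Topology

lemma log_factorial_eq_sum_primesLE (N : ℕ) :
    log (N.factorial : ℝ) = ∑ p ∈ N.primesLE, (N.factorial.factorization p : ℝ) * log p := by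
  rw [log_nat_eq_sum_factorization, Finsupp.sum]
  refine Finset.sum_subset (fun p hp => ?_) (fun p _ hp => ?_)
  · rw [Nat.support_factorization] at hp
    have hp' := Nat.prime_of_mem_primeFactors hp
    exact Nat.mem_primesLE.2 ⟨(hp'.dvd_factorial).1 (Nat.dvd_of_mem_primeFactors hp), hp'⟩
  · simp [Finsupp.notMem_support_iff.1 hp]

lemma div_le_factorization_factorial {p : ℕ} (hp : p.Prime) (N : ℕ) :
    N / p ≤ N.factorial.factorization p := by
  rw [Nat.factorization_factorial hp (b := Nat.log p N + 2) (by omega)]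
  simpa using Finset.single_le_sum (f := fun i => N / p ^ i) (fun i _ => Nat.zero_le _)
    (show 1 ∈ Finset.Ico 1 (Nat.log p N + 2) by simp)

/-- The upper half of Mertens' first theorem. -/
lemma sum_log_div_primesLE_le {N : ℕ} (hN : 0 < N) :
    ∑ p ∈ N.primesLE, log p / p ≤ log N + log 4 := by
  have hN' : (0 : ℝ) < N := by exact_mod_cast hN
  have h1 : log (N.factorial : ℝ) ≤ N * log N := by
    rw [← log_pow]
    refine log_le_log (by exact_mod_cast N.factorial_pos) ?_
    exact_mod_cast Nat.factorial_le_pow N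
  have h2 : ∑ p ∈ N.primesLE, ((N : ℝ) / p - 1) * log p ≤ log (N.factorial : ℝ) := by
    rw [log_factorial_eq_sum_primesLE]
    refine Finset.sum_le_sum fun p hp => ?_
    have hp' := (Nat.mem_primesLE.1 hp).2
    refine mul_le_mul_of_nonneg_right ?_ (log_natCast_nonneg p)
    have h3 : ((N / p : ℕ) : ℝ) ≤ N.factorial.factorization p := by
      exact_mod_cast div_le_factorization_factorial hp' N
    have h4 := Nat.lt_floor_add_one ((N : ℝ) / p)
    rw [Nat.floor_div_eq_div] at h4
    linarith
  have h3 : ∑ p ∈ N.primesLE, log p ≤ log 4 * N := by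
    rw [← Chebyshev.theta_eq_sum_primesLE_log]
    exact Chebyshev.theta_le_log4_mul_x hN'.le
  have h4 : ∑ p ∈ N.primesLE, ((N : ℝ) / p - 1) * log p
      = N * ∑ p ∈ N.primesLE, log p / p - ∑ p ∈ N.primesLE, log p := by
    rw [Finset.mul_sum, ← Finset.sum_sub_distrib]
    exact Finset.sum_congr rfl fun p _ => by ring
  refine le_of_mul_le_mul_left (a := (N : ℝ)) ?_ hN'
  linarith

lemma log_div_mul_sub_one_le {p : ℕ} (hp : 2 ≤ p) :
    log p / (p * (p - 1)) ≤ 4 * (1 / (p : ℝ) ^ (3 / 2 : ℝ)) := by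
  have hp' : (2 : ℝ) ≤ p := by exact_mod_cast hp
  have h0 : (0 : ℝ) < p := by linarith
  have h1 : log p ≤ 2 * (p : ℝ) ^ (1 / 2 : ℝ) := by
    have := log_le_rpow_div h0.le (show (0 : ℝ) < 1 / 2 by norm_num)
    linarith
  have h2 : (p : ℝ) ^ (1 / 2 : ℝ) * (p : ℝ) ^ (3 / 2 : ℝ) = p ^ 2 := by
    rw [← rpow_add h0]; norm_num
  have h3 : (0 : ℝ) < (p : ℝ) ^ (3 / 2 : ℝ) := rpow_pos_of_pos h0 _
  rw [mul_one_div, div_le_div_iff₀ (by nlinarith) h3]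
  calc log p * (p : ℝ) ^ (3 / 2 : ℝ)
      ≤ 2 * (p : ℝ) ^ (1 / 2 : ℝ) * (p : ℝ) ^ (3 / 2 : ℝ) := by gcongr
    _ = 2 * p ^ 2 := by rw [mul_assoc, h2]
    _ ≤ 4 * (p * (p - 1)) := by nlinarith

/-- The lower half of Mertens' first theorem. -/
lemma exists_log_le_sum_log_div_primesLE :
    ∃ C : ℝ, ∀ N : ℕ, 0 < N → log N ≤ ∑ p ∈ N.primesLE, log p / p + C := by
  have hs : Summable fun n : ℕ => 4 * (1 / (n : ℝ) ^ (3 / 2 : ℝ)) :=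
    (summable_one_div_nat_rpow.2 (by norm_num)).mul_left 4
  refine ⟨1 + ∑' n : ℕ, 4 * (1 / (n : ℝ) ^ (3 / 2 : ℝ)), fun N hN => ?_⟩
  have hN' : (0 : ℝ) < N := by exact_mod_cast hN
  have h1 : N * log N - N ≤ log (N.factorial : ℝ) := by
    have hf : (0 : ℝ) < N.factorial := by exact_mod_cast N.factorial_pos
    have := log_le_log (by positivity) (pow_div_factorial_le_exp (N : ℝ) hN'.le N)
    rw [log_exp, log_div (by positivity) hf.ne', log_pow] at this
    linarith
  have h2 : log (N.factorial : ℝ) ≤ ∑ p ∈ N.primesLE,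
      (N * (log p / p) + N * (4 * (1 / (p : ℝ) ^ (3 / 2 : ℝ)))) := by
    rw [log_factorial_eq_sum_primesLE]
    refine Finset.sum_le_sum fun p hp => ?_
    have hp' := (Nat.mem_primesLE.1 hp).2
    have hp2 : (2 : ℝ) ≤ p := by exact_mod_cast hp'.two_le
    have h3 : (N.factorial.factorization p : ℝ) ≤ N / (p - 1) := by
      have h : (N.factorial.factorization p : ℝ) ≤ ((N / (p - 1) : ℕ) : ℝ) := by
        exact_mod_cast Nat.factorization_factorial_le_div_pred hp' N
      refine h.trans (Nat.cast_div_le.trans_eq ?_)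
      rw [Nat.cast_sub hp'.one_le, Nat.cast_one]
    calc (N.factorial.factorization p : ℝ) * log p ≤ N / (p - 1) * log p :=
          mul_le_mul_of_nonneg_right h3 (log_natCast_nonneg p)
      _ = N * (log p / p) + N * (log p / (p * (p - 1))) := by
          have : (p : ℝ) - 1 ≠ 0 := by linarith
          field_simp
          ring
      _ ≤ _ := by
          have := log_div_mul_sub_one_le hp'.two_le
          gcongr
  rw [Finset.sum_add_distrib, ← Finset.mul_sum, ← Finset.mul_sum] at h2
  have h3 := hs.sum_le_tsum N.primesLE (fun n _ => by positivity)
  refine le_of_mul_le_mul_left (a := (N : ℝ)) ?_ hN'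
  nlinarith

/-- The primes up to `exp k`. -/
noncomputable def primesLEExp (k : ℕ) : Finset ℕ := Nat.primesLE ⌊exp k⌋₊

lemma mem_primesLEExp {k p : ℕ} : p ∈ primesLEExp k ↔ p.Prime ∧ (p : ℝ) ≤ exp k := by
  rw [primesLEExp, Nat.mem_primesLE, Nat.le_floor_iff (exp_pos _).le, and_comm]

lemma primesLEExp_zero : primesLEExp 0 = ∅ := by
  ext p
  simp only [mem_primesLEExp, Finset.notMem_empty, iff_false, not_and, not_le]
  intro hp
  simpa using hp.one_lt

lemma primesLEExp_mono : Monotone primesLEExp := fun k l hkl p hp => by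
  rw [mem_primesLEExp] at hp ⊢
  exact ⟨hp.1, hp.2.trans (exp_le_exp.2 (by exact_mod_cast hkl))⟩

/-- Mertens' first theorem along the sequence `exp k`. -/
lemma exists_abs_sum_log_div_primesLEExp_sub_le :
    ∃ C : ℝ, ∀ k : ℕ, |∑ p ∈ primesLEExp k, log p / p - k| ≤ C := by
  obtain ⟨C, hC⟩ := exists_log_le_sum_log_div_primesLE
  refine ⟨max (log 4) (C + 1), fun k => ?_⟩
  have h1 : (1 : ℝ) ≤ exp k := one_le_exp (Nat.cast_nonneg k)
  have hpos : 0 < ⌊exp k⌋₊ := Nat.floor_pos.2 h1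
  have hpos' : (1 : ℝ) ≤ ⌊exp k⌋₊ := by exact_mod_cast hpos
  have h2 : log ⌊exp k⌋₊ ≤ k := by
    rw [log_le_iff_le_exp (by linarith)]
    exact Nat.floor_le (exp_pos _).le
  have h3 : (k : ℝ) ≤ log ⌊exp k⌋₊ + 1 := by
    have h4 : exp k ≤ exp 1 * ⌊exp k⌋₊ := by
      have := Nat.lt_floor_add_one (exp (k : ℝ))
      have := add_one_le_exp (1 : ℝ)
      nlinarith
    have := log_le_log (exp_pos _) h4
    rw [log_exp, log_mul (exp_pos _).ne' (by linarith), log_exp] at this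
    linarith
  have h5 := sum_log_div_primesLE_le hpos
  have h6 := hC _ hpos
  rw [abs_le, primesLEExp]
  have := le_max_left (log 4) (C + 1)
  have := le_max_right (log 4) (C + 1)
  constructor <;> linarith

lemma sum_range_sum_primesLEExp_sdiff (g : ℕ → ℝ) (K : ℕ) :
    ∑ k ∈ Finset.range K, ∑ p ∈ primesLEExp (k + 1) \ primesLEExp k, g p
      = ∑ p ∈ primesLEExp K, g p := by
  induction K with
  | zero => simp [primesLEExp_zero]
  | succ K ih =>
    rw [Finset.sum_range_succ, ih, add_comm, Finset.sum_sdiff (primesLEExp_mono K.le_succ)]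

lemma mem_primesLEExp_sdiff {k p : ℕ} (hp : p ∈ primesLEExp (k + 1) \ primesLEExp k) :
    p.Prime ∧ (k : ℝ) ≤ log p ∧ log p ≤ k + 1 := by
  rw [Finset.mem_sdiff, mem_primesLEExp, mem_primesLEExp] at hp
  obtain ⟨⟨hp, h1⟩, h2⟩ := hp
  have h0 : (0 : ℝ) < p := by exact_mod_cast hp.pos
  refine ⟨hp, ?_, ?_⟩
  · rw [le_log_iff_exp_le h0]
    exact (not_le.1 fun h => h2 ⟨hp, h⟩).le
  · rw [log_le_iff_le_exp h0]
    exact_mod_cast h1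

/-- The sum of the reciprocals of the primes in `(exp k, exp (k + 1)]`. -/
noncomputable def blockSum (k : ℕ) : ℝ :=
  ∑ p ∈ primesLEExp (k + 1) \ primesLEExp k, 1 / (p : ℝ)

/-- The sum of `log p / p` over the primes in `(exp k, exp (k + 1)]`. -/
noncomputable def logBlockSum (k : ℕ) : ℝ :=
  ∑ p ∈ primesLEExp (k + 1) \ primesLEExp k, log p / p

lemma blockSum_nonneg (k : ℕ) : 0 ≤ blockSum k :=
  Finset.sum_nonneg fun p _ => by positivity

lemma mul_blockSum_le_logBlockSum (k : ℕ) : k * blockSum k ≤ logBlockSum k := by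
  rw [blockSum, logBlockSum, Finset.mul_sum]
  refine Finset.sum_le_sum fun p hp => ?_
  rw [mul_one_div]
  exact div_le_div_of_nonneg_right (mem_primesLEExp_sdiff hp).2.1 (Nat.cast_nonneg p)

lemma logBlockSum_le_mul_blockSum (k : ℕ) : logBlockSum k ≤ (k + 1) * blockSum k := by
  rw [blockSum, logBlockSum, Finset.mul_sum]
  refine Finset.sum_le_sum fun p hp => ?_
  rw [mul_one_div]
  exact div_le_div_of_nonneg_right (mem_primesLEExp_sdiff hp).2.2 (Nat.cast_nonneg p)

lemma blockSum_le_two_mul_logBlockSum (k : ℕ) : blockSum k ≤ 2 * logBlockSum k := by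
  rw [blockSum, logBlockSum, Finset.mul_sum]
  refine Finset.sum_le_sum fun p hp => ?_
  have hp' := (mem_primesLEExp_sdiff hp).1
  rw [← mul_div_assoc]
  refine div_le_div_of_nonneg_right ?_ (Nat.cast_nonneg p)
  have := log_le_log two_pos (show (2 : ℝ) ≤ p by exact_mod_cast hp'.two_le)
  linarith [log_two_gt_d9]

lemma exists_logBlockSum_le : ∃ C : ℝ, ∀ k, logBlockSum k ≤ C := by
  obtain ⟨C, hC⟩ := exists_abs_sum_log_div_primesLEExp_sub_le
  refine ⟨2 * C + 1, fun k => ?_⟩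
  have h := sum_range_sum_primesLEExp_sdiff (fun p => log p / p) (k + 1)
  rw [Finset.sum_range_succ, sum_range_sum_primesLEExp_sdiff] at h
  have h1 := abs_le.1 (hC k)
  have h2 := abs_le.1 (hC (k + 1))
  push_cast at h2
  rw [logBlockSum]
  linarith

lemma exists_blockSum_le : ∃ C : ℝ, ∀ k : ℕ, blockSum k ≤ C / (k + 1) := by
  obtain ⟨C, hC⟩ := exists_logBlockSum_le
  refine ⟨3 * C, fun k => ?_⟩
  rw [le_div_iff₀ (by positivity)]
  have := mul_blockSum_le_logBlockSum k
  have := blockSum_le_two_mul_logBlockSum k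
  have := hC k
  linarith

/-- A form of Mertens' second theorem: the sum of the reciprocals of the primes up to `exp K`
differs from the `K`-th harmonic number by a convergent sequence. -/
lemma exists_tendsto_sum_blockSum_sub :
    ∃ B : ℝ, Tendsto (fun K : ℕ => ∑ k ∈ Finset.range K, (blockSum k - 1 / ((k : ℝ) + 1)))
      atTop (𝓝 B) := by
  obtain ⟨C, hC⟩ := exists_abs_sum_log_div_primesLEExp_sub_le
  obtain ⟨C', hC'⟩ := exists_blockSum_le
  have h1 : CauchySeq fun n : ℕ =>
      ∑ k ∈ Finset.range n, (1 / ((k : ℝ) + 1)) • (logBlockSum k - 1) := by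
    refine Antitone.cauchySeq_series_mul_of_tendsto_zero_of_bounded (b := C) ?_
      tendsto_one_div_add_atTop_nhds_zero_nat fun n => ?_
    · exact fun k l hkl => Nat.one_div_le_one_div hkl
    · rw [Finset.sum_sub_distrib, norm_eq_abs]
      simpa [logBlockSum, sum_range_sum_primesLEExp_sdiff (fun p => log p / p)] using hC n
  obtain ⟨B₁, hB₁⟩ := cauchySeq_tendsto_of_complete h1
  have h2 : Summable fun k : ℕ => blockSum k - logBlockSum k / (k + 1) := by
    have hs : Summable fun k : ℕ => C' * (1 / ((k + 1 : ℕ) : ℝ) ^ 2) :=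
      ((summable_nat_add_iff 1).2 (summable_one_div_nat_pow.2 one_lt_two)).mul_left C'
    refine Summable.of_nonneg_of_le (fun k => ?_) (fun k => ?_) hs
    · rw [sub_nonneg, div_le_iff₀ (by positivity), mul_comm]
      exact logBlockSum_le_mul_blockSum k
    · have h3 := mul_blockSum_le_logBlockSum k
      have h4 := hC' k
      have h5 : (0 : ℝ) < k + 1 := by positivity
      calc blockSum k - logBlockSum k / (k + 1)
          = ((k + 1) * blockSum k - logBlockSum k) / (k + 1) := by field_simp
        _ ≤ C' / (k + 1) / (k + 1) := by gcongr; linarith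
        _ = _ := by push_cast; field_simp
  refine ⟨_, (h2.hasSum.tendsto_sum_nat.add hB₁).congr fun n => ?_⟩
  rw [← Finset.sum_add_distrib]
  refine Finset.sum_congr rfl fun k _ => ?_
  rw [smul_eq_mul]
  field_simp
  ring

lemma prod_primes_le_tsum {σ : ℝ} (hσ : 1 < σ) (F : Finset Nat.Primes) :
    ∏ p ∈ F, (1 - ((p : ℕ) : ℝ) ^ (-σ))⁻¹ ≤ ∑' n : ℕ, 1 / (n : ℝ) ^ σ := by
  let f : ℕ →*₀ ℝ :=
    { toFun := fun n => (n : ℝ) ^ (-σ)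
      map_zero' := by simp [zero_rpow (by linarith : -σ ≠ 0)]
      map_one' := by simp
      map_mul' := fun m n => by
        push_cast
        exact mul_rpow (Nat.cast_nonneg m) (Nat.cast_nonneg n) }
  have hf : ∀ n : ℕ, f n = 1 / (n : ℝ) ^ σ := fun n => by
    rw [one_div, ← rpow_neg (Nat.cast_nonneg n)]; rfl
  have hs : Summable fun n => ‖f n‖ := by
    refine (summable_one_div_nat_rpow.2 hσ).congr fun n => ?_
    rw [hf, norm_of_nonneg (by positivity)]
  have h := EulerProduct.eulerProduct_completely_multiplicative_hasProd hs
  simp only [hf] at h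
  have hσ' : ∀ p : Nat.Primes, (1 : ℝ) ≤ (1 - 1 / ((p : ℕ) : ℝ) ^ σ)⁻¹ := fun p => by
    have hp : (1 : ℝ) < (p : ℕ) := by exact_mod_cast p.2.one_lt
    have h1 : 1 < ((p : ℕ) : ℝ) ^ σ := one_lt_rpow hp (by linarith)
    refine one_le_inv_iff₀.2 ⟨?_, ?_⟩
    · rw [sub_pos, div_lt_one (by linarith)]
      exact h1
    · simpa using rpow_nonneg (Nat.cast_nonneg _) _
  refine ge_of_tendsto h ?_
  rw [SummationFilter.unconditional_filter]
  filter_upwards [eventually_ge_atTop F] with S hS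
  rw [← Finset.prod_sdiff hS]
  simp only [rpow_neg (Nat.cast_nonneg _), one_div] at hσ' ⊢
  refine le_mul_of_one_le_left (Finset.prod_nonneg fun p _ => zero_le_one.trans (hσ' p)) ?_
  exact Finset.one_le_prod fun p _ => hσ' p

lemma sum_neg_log_le_log_tsum {σ : ℝ} (hσ : 1 < σ) (K : ℕ) :
    ∑ p ∈ primesLEExp K, -log (1 - (p : ℝ) ^ (-σ)) ≤ log (∑' n : ℕ, 1 / (n : ℝ) ^ σ) := by
  have hpos : ∀ p ∈ primesLEExp K, 0 < 1 - (p : ℝ) ^ (-σ) := fun p hp => by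
    have h : (1 : ℝ) < p := by exact_mod_cast (mem_primesLEExp.1 hp).1.one_lt
    have := rpow_lt_one_of_one_lt_of_neg h (by linarith : -σ < 0)
    linarith
  have h := prod_primes_le_tsum hσ ((primesLEExp K).subtype Nat.Prime)
  replace h := (Finset.prod_subtype_of_mem (fun p : ℕ => (1 - (p : ℝ) ^ (-σ))⁻¹)
    (fun p hp => (mem_primesLEExp.1 hp).1)).symm.trans_le h
  have h1 := log_le_log (Finset.prod_pos fun p hp => inv_pos.2 (hpos p hp)) h
  rw [log_prod fun p hp => (inv_pos.2 (hpos p hp)).ne'] at h1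
  simpa only [log_inv] using h1

lemma sum_blockSum_mul_exp_le {s : ℝ} (hs : 0 < s) (K : ℕ) :
    ∑ k ∈ Finset.range K, blockSum k * exp (-s) ^ (k + 1)
      ≤ ∑ p ∈ primesLEExp K, (p : ℝ) ^ (-(1 + s)) := by
  rw [← sum_range_sum_primesLEExp_sdiff]
  refine Finset.sum_le_sum fun k _ => ?_
  rw [blockSum, Finset.sum_mul]
  refine Finset.sum_le_sum fun p hp => ?_
  obtain ⟨hp, -, h⟩ := mem_primesLEExp_sdiff hp
  have h0 : (0 : ℝ) < p := by exact_mod_cast hp.pos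
  rw [neg_add, rpow_add h0, rpow_neg_one, one_div, ← exp_nat_mul, rpow_def_of_pos h0]
  refine mul_le_mul_of_nonneg_left (exp_le_exp.2 ?_) (by positivity)
  push_cast
  nlinarith

lemma tsum_blockSum_sub_mul_exp_le {s : ℝ} (hs : 0 < s) (J : ℕ) :
    (∑' k : ℕ, (blockSum k - 1 / ((k : ℝ) + 1)) * exp (-s) ^ k) * exp (-s)
      + ∑ p ∈ primesLEExp J, (-log (1 - (p : ℝ) ^ (-(1 + s))) - (p : ℝ) ^ (-(1 + s)))
      ≤ log (s * (∑' n : ℕ, 1 / (n : ℝ) ^ (1 + s)) * ((1 - exp (-s)) / s)) := by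
  set x := exp (-s) with hx
  have hx0 : 0 < x := exp_pos _
  have hx1 : x < 1 := Real.exp_lt_one_iff.2 (by linarith)
  have hZ : 0 < ∑' n : ℕ, 1 / (n : ℝ) ^ (1 + s) := by
    have h := prod_primes_le_tsum (show 1 < 1 + s by linarith) ∅
    rw [Finset.prod_empty] at h
    linarith
  have hlog : log (s * (∑' n : ℕ, 1 / (n : ℝ) ^ (1 + s)) * ((1 - x) / s))
      = log (∑' n : ℕ, 1 / (n : ℝ) ^ (1 + s)) + log (1 - x) := by
    rw [← log_mul hZ.ne' (by linarith)]
    congr 1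
    field_simp
  have h1 : HasSum (fun k : ℕ => x ^ (k + 1) / ((k : ℝ) + 1)) (-log (1 - x)) :=
    hasSum_pow_div_log_of_abs_lt_one (by rwa [abs_of_pos hx0])
  have h2 : Summable fun k : ℕ => blockSum k * x ^ (k + 1) := by
    obtain ⟨C, hC⟩ := exists_blockSum_le
    refine Summable.of_nonneg_of_le (fun k => mul_nonneg (blockSum_nonneg k) (by positivity))
      (fun k => ?_) (h1.summable.mul_left C)
    calc blockSum k * x ^ (k + 1) ≤ C / (k + 1) * x ^ (k + 1) := by
          have := hC k
          gcongr
      _ = _ := by ring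
  have h3 : (∑' k : ℕ, (blockSum k - 1 / ((k : ℝ) + 1)) * x ^ k) * x
      = ∑' k : ℕ, blockSum k * x ^ (k + 1) + log (1 - x) := by
    rw [← tsum_mul_right, ← sub_neg_eq_add, ← h1.tsum_eq, ← h2.tsum_sub h1.summable]
    exact tsum_congr fun k => by ring
  have h4 : ∑' k : ℕ, blockSum k * x ^ (k + 1) ≤ log (∑' n : ℕ, 1 / (n : ℝ) ^ (1 + s))
      - ∑ p ∈ primesLEExp J, (-log (1 - (p : ℝ) ^ (-(1 + s))) - (p : ℝ) ^ (-(1 + s))) := by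
    refine le_of_tendsto h2.hasSum.tendsto_sum_nat ?_
    filter_upwards [eventually_ge_atTop J] with K hK
    have h5 := sum_blockSum_mul_exp_le hs K
    have h6 := sum_neg_log_le_log_tsum (show 1 < 1 + s by linarith) K
    have h7 : ∑ p ∈ primesLEExp J, (-log (1 - (p : ℝ) ^ (-(1 + s))) - (p : ℝ) ^ (-(1 + s)))
        ≤ ∑ p ∈ primesLEExp K, (-log (1 - (p : ℝ) ^ (-(1 + s))) - (p : ℝ) ^ (-(1 + s))) := by
      refine Finset.sum_le_sum_of_subset_of_nonneg (primesLEExp_mono hK) fun p hp _ => ?_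
      have hp1 : (1 : ℝ) < p := by exact_mod_cast (mem_primesLEExp.1 hp).1.one_lt
      have hp2 := rpow_lt_one_of_one_lt_of_neg hp1 (by linarith : -(1 + s) < 0)
      have := log_le_sub_one_of_pos (by linarith : 0 < 1 - (p : ℝ) ^ (-(1 + s)))
      linarith
    rw [Finset.sum_sub_distrib (s := primesLEExp K)] at h7
    linarith
  rw [hlog, h3]
  linarith

/-- Comparison of the constant in Mertens' second theorem with the Riemann zeta function
near `1`. -/
lemma add_sum_neg_log_sub_le_zero {B : ℝ}
    (hB : Tendsto (fun K : ℕ => ∑ k ∈ Finset.range K, (blockSum k - 1 / ((k : ℝ) + 1)))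
      atTop (𝓝 B)) (J : ℕ) :
    B + ∑ p ∈ primesLEExp J, (-log (1 - 1 / (p : ℝ)) - 1 / (p : ℝ)) ≤ 0 := by
  have hid : Tendsto (fun s : ℝ => s) (𝓝[>] 0) (𝓝 0) := nhdsWithin_le_nhds
  have hexp : Tendsto (fun s : ℝ => exp (-s)) (𝓝[>] 0) (𝓝 1) := by
    simpa [Function.comp_def] using (continuous_exp.tendsto _).comp hid.neg
  have hexp' : Tendsto (fun s : ℝ => exp (-s)) (𝓝[>] 0) (𝓝[<] 1) := by
    refine tendsto_nhdsWithin_iff.2 ⟨hexp, ?_⟩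
    filter_upwards [self_mem_nhdsWithin] with s hs
    exact Real.exp_lt_one_iff.2 (by simpa using hs)
  have h1 := (tendsto_tsum_powerSeries_nhdsWithin_lt hB).comp hexp'
  have h2 : Tendsto (fun s : ℝ => ∑ p ∈ primesLEExp J,
      (-log (1 - (p : ℝ) ^ (-(1 + s))) - (p : ℝ) ^ (-(1 + s)))) (𝓝[>] 0)
      (𝓝 (∑ p ∈ primesLEExp J, (-log (1 - 1 / (p : ℝ)) - 1 / (p : ℝ)))) := by
    refine tendsto_finsetSum _ fun p hp => ?_
    have hp1 : (1 : ℝ) < p := by exact_mod_cast (mem_primesLEExp.1 hp).1.one_lt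
    have h3 : Tendsto (fun s : ℝ => (p : ℝ) ^ (-(1 + s))) (𝓝[>] 0) (𝓝 (1 / (p : ℝ))) := by
      have := (continuousAt_const_rpow (a := (p : ℝ)) (by linarith)).tendsto.comp
        ((hid.const_add 1).neg)
      simpa [Function.comp_def, rpow_neg_one] using this
    have h4 : 1 / (p : ℝ) < 1 := by rw [div_lt_one (by linarith)]; exact hp1
    exact ((h3.const_sub 1).log (by linarith)).neg.sub h3
  have h5 : Tendsto (fun s : ℝ => s * ∑' n : ℕ, 1 / (n : ℝ) ^ (1 + s)) (𝓝[>] 0) (𝓝 1) := by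
    have h6 : Tendsto (fun s : ℝ => 1 + s) (𝓝[>] 0) (𝓝[>] 1) := by
      refine tendsto_nhdsWithin_iff.2 ⟨by simpa using hid.const_add 1, ?_⟩
      filter_upwards [self_mem_nhdsWithin] with s hs
      simpa using hs
    simpa [Function.comp_def] using tendsto_sub_mul_tsum_nat_rpow.comp h6
  have h6 : Tendsto (fun s : ℝ => (1 - exp (-s)) / s) (𝓝[>] 0) (𝓝 1) := by
    have h7 : HasDerivAt (fun s : ℝ => 1 - exp (-s)) 1 0 := by
      simpa using ((hasDerivAt_neg (0 : ℝ)).exp).const_sub 1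
    have h8 := h7.tendsto_slope_zero_right
    simpa [div_eq_inv_mul] using h8
  have h7 := (h5.mul h6).log (by norm_num)
  rw [mul_one, log_one] at h7
  have h8 := (h1.mul hexp).add h2
  rw [mul_one] at h8
  refine le_of_tendsto_of_tendsto h8 h7 ?_
  filter_upwards [self_mem_nhdsWithin] with s hs
  exact tsum_blockSum_sub_mul_exp_le hs J

/-- The upper half of Mertens' third theorem, along the sequence `exp K`. -/
lemma eventually_prod_primesLEExp_le {c : ℝ} (hc : exp eulerMascheroniConstant < c) :
    ∀ᶠ K : ℕ in atTop, ∏ p ∈ primesLEExp K, (1 - 1 / (p : ℝ))⁻¹ ≤ c * K := by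
  obtain ⟨B, hB⟩ := exists_tendsto_sum_blockSum_sub
  have h1 : Tendsto (fun K : ℕ => exp (∑ k ∈ Finset.range K, (blockSum k - 1 / ((k : ℝ) + 1))
      + ((harmonic K : ℝ) - log K) - B)) atTop (𝓝 (exp eulerMascheroniConstant)) := by
    have := (hB.add tendsto_harmonic_sub_log).sub_const B
    rw [add_sub_cancel_left] at this
    exact (continuous_exp.tendsto _).comp this
  filter_upwards [h1.eventually_lt_const hc, eventually_gt_atTop 0] with K hK hK0
  have hK0' : (0 : ℝ) < K := by exact_mod_cast hK0
  have h2 := add_sum_neg_log_sub_le_zero hB K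
  have h3 := sum_range_sum_primesLEExp_sdiff (fun p => 1 / (p : ℝ)) K
  have h4 : (harmonic K : ℝ) = ∑ k ∈ Finset.range K, 1 / ((k : ℝ) + 1) := by
    simp [harmonic]
  have h5 : ∑ k ∈ Finset.range K, (blockSum k - 1 / ((k : ℝ) + 1))
      = ∑ p ∈ primesLEExp K, 1 / (p : ℝ) - harmonic K := by
    rw [Finset.sum_sub_distrib, h4, ← h3]
    rfl
  rw [Finset.sum_sub_distrib] at h2
  have h6 : ∏ p ∈ primesLEExp K, (1 - 1 / (p : ℝ))⁻¹
      = exp (∑ p ∈ primesLEExp K, -log (1 - 1 / (p : ℝ))) := by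
    rw [exp_sum]
    refine Finset.prod_congr rfl fun p hp => ?_
    have hp1 : (1 : ℝ) < p := by exact_mod_cast (mem_primesLEExp.1 hp).1.one_lt
    have h7 : 1 / (p : ℝ) < 1 := by rw [div_lt_one (by linarith)]; exact hp1
    rw [exp_neg, exp_log (by linarith)]
  have h7 : exp (∑ p ∈ primesLEExp K, -log (1 - 1 / (p : ℝ)))
      ≤ exp (∑ k ∈ Finset.range K, (blockSum k - 1 / ((k : ℝ) + 1))
        + ((harmonic K : ℝ) - log K) - B) * K := by
    rw [← div_le_iff₀ hK0', div_eq_mul_inv, ← exp_log (inv_pos.2 hK0'), ← exp_add, log_inv]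
    refine exp_le_exp.2 ?_
    linarith
  rw [h6]
  exact h7.trans (by gcongr)

/-- The few prime factors of `n` exceeding `log n` barely contribute to an Euler product. -/
lemma prod_large_primeFactors_le {n : ℕ} (hn : 2 ≤ log n) {S : Finset ℕ}
    (hS : S ⊆ n.primeFactors) (hS' : ∀ p ∈ S, log n ≤ p) :
    ∏ p ∈ S, (1 - 1 / (p : ℝ))⁻¹ ≤ exp (2 / log (log n)) := by
  set y := log n with hy
  have hly : 0 < log y := log_pos (by linarith)
  have hn0 : n ≠ 0 := by
    rintro rfl
    norm_num [hy] at hn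
  have h1 : y ^ S.card ≤ n := by
    calc y ^ S.card ≤ ∏ p ∈ S, (p : ℝ) :=
          (Finset.prod_const y).symm.trans_le (Finset.prod_le_prod (fun _ _ => by linarith) hS')
      _ = ((∏ p ∈ S, p : ℕ) : ℝ) := by push_cast; rfl
      _ ≤ n := by
          exact_mod_cast Nat.le_of_dvd (Nat.pos_of_ne_zero hn0)
            ((Finset.prod_dvd_prod_of_subset _ _ _ hS).trans n.prod_primeFactors_dvd)
  have h2 : S.card * log y ≤ y := by
    rw [← log_pow]
    exact log_le_log (by positivity) h1
  have h3 : ∀ p ∈ S, (1 - 1 / (p : ℝ))⁻¹ ≤ exp (2 / y) := fun p hp => by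
    have hp := hS' p hp
    have hp1 : (0 : ℝ) < p - 1 := by linarith
    calc (1 - 1 / (p : ℝ))⁻¹ = 1 / (p - 1) + 1 := by
          have : (p : ℝ) ≠ 0 := by linarith
          field_simp
          ring
      _ ≤ 2 / y + 1 := by
          gcongr ?_ + 1
          rw [div_le_div_iff₀ hp1 (by linarith)]
          linarith
      _ ≤ exp (2 / y) := add_one_le_exp _
  calc ∏ p ∈ S, (1 - 1 / (p : ℝ))⁻¹ ≤ ∏ _p ∈ S, exp (2 / y) :=
        Finset.prod_le_prod (fun p _ => inv_nonneg.2 (Nat.one_sub_one_div_cast_nonneg p)) h3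
    _ = exp (S.card * (2 / y)) := by rw [Finset.prod_const, ← exp_nat_mul]
    _ ≤ exp (2 / log y) := by
        refine exp_le_exp.2 ?_
        rw [mul_div_assoc', div_le_div_iff₀ (by linarith) hly]
        linarith

/-- The primes up to (roughly) `log n`, together with the prime factors of `n`. -/
noncomputable def smallOrDividing (n : ℕ) : Finset ℕ :=
  primesLEExp ⌈log (log n)⌉₊ ∪ n.primeFactors

lemma prime_of_mem_smallOrDividing {n p : ℕ} (hp : p ∈ smallOrDividing n) : p.Prime := by
  rcases Finset.mem_union.1 hp with hp | hp
  · exact (mem_primesLEExp.1 hp).1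
  · exact Nat.prime_of_mem_primeFactors hp

lemma tendsto_log_natCast : Tendsto (fun n : ℕ => log (n : ℝ)) atTop atTop :=
  tendsto_log_atTop.comp tendsto_natCast_atTop_atTop

lemma tendsto_log_log_natCast : Tendsto (fun n : ℕ => log (log (n : ℝ))) atTop atTop :=
  tendsto_log_atTop.comp tendsto_log_natCast

lemma eventually_prod_smallOrDividing_le {c : ℝ} (hc : exp eulerMascheroniConstant < c) :
    ∀ᶠ n : ℕ in atTop, ∏ p ∈ smallOrDividing n, (1 - 1 / (p : ℝ))⁻¹ ≤ c * log (log n) := by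
  obtain ⟨c', hc', hcc⟩ := exists_between hc
  have hc0 : 0 < c' := (exp_pos _).trans hc'
  have hK : Tendsto (fun n : ℕ => ⌈log (log (n : ℝ))⌉₊) atTop atTop :=
    tendsto_nat_ceil_atTop.comp tendsto_log_log_natCast
  have hlim : Tendsto (fun n : ℕ => c' * (1 + 1 / log (log (n : ℝ)))
      * exp (2 / log (log (n : ℝ)))) atTop (𝓝 c') := by
    have h1 := (tendsto_log_log_natCast.const_div_atTop 1).const_add 1
    have h2 := (continuous_exp.tendsto _).comp (tendsto_log_log_natCast.const_div_atTop 2)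
    simpa [Function.comp_def] using (h1.const_mul c').mul h2
  filter_upwards [hlim.eventually_lt_const hcc, hK.eventually (eventually_prod_primesLEExp_le hc'),
    tendsto_log_natCast.eventually_ge_atTop 2,
    tendsto_log_log_natCast.eventually_gt_atTop 0] with n h1 h2 h3 h4
  set L := log (log (n : ℝ)) with hL
  have h5 : ∏ p ∈ smallOrDividing n \ primesLEExp ⌈L⌉₊, (1 - 1 / (p : ℝ))⁻¹ ≤ exp (2 / L) := by
    refine prod_large_primeFactors_le h3 (fun p hp => ?_) (fun p hp => ?_)
    · rw [smallOrDividing, Finset.union_sdiff_left] at hp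
      exact (Finset.mem_sdiff.1 hp).1
    · obtain ⟨hp, hp'⟩ := Finset.mem_sdiff.1 hp
      rw [mem_primesLEExp, not_and, not_le] at hp'
      refine le_trans ?_ (hp' (prime_of_mem_smallOrDividing hp)).le
      rw [← log_le_iff_le_exp (by linarith)]
      exact Nat.le_ceil _
  have h6 : 0 ≤ ∏ p ∈ primesLEExp ⌈L⌉₊, (1 - 1 / (p : ℝ))⁻¹ :=
    Finset.prod_nonneg fun p _ => inv_nonneg.2 (Nat.one_sub_one_div_cast_nonneg p)
  calc ∏ p ∈ smallOrDividing n, (1 - 1 / (p : ℝ))⁻¹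
      = (∏ p ∈ smallOrDividing n \ primesLEExp ⌈L⌉₊, (1 - 1 / (p : ℝ))⁻¹)
        * ∏ p ∈ primesLEExp ⌈L⌉₊, (1 - 1 / (p : ℝ))⁻¹ :=
        (Finset.prod_sdiff Finset.subset_union_left).symm
    _ ≤ exp (2 / L) * (c' * ⌈L⌉₊) := by gcongr
    _ ≤ exp (2 / L) * (c' * (L + 1)) := by
        have := (Nat.ceil_lt_add_one h4.le).le
        gcongr
    _ = c' * (1 + 1 / L) * exp (2 / L) * L := by
        field_simp
    _ ≤ c * L := by gcongr

lemma tendsto_subtype_smallOrDividing :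
    Tendsto (fun n : ℕ => ((smallOrDividing n).subtype Nat.Prime : Finset Nat.Primes))
      atTop atTop := by
  refine tendsto_atTop.2 fun F => ?_
  have h : Tendsto (fun n : ℕ => exp (⌈log (log (n : ℝ))⌉₊ : ℝ)) atTop atTop :=
    tendsto_exp_atTop.comp (tendsto_natCast_atTop_atTop.comp
      (tendsto_nat_ceil_atTop.comp tendsto_log_log_natCast))
  have h' : ∀ᶠ n : ℕ in atTop, ∀ p ∈ F, ((p : ℕ) : ℝ) ≤ exp (⌈log (log (n : ℝ))⌉₊ : ℝ) :=
    (Finset.eventually_all F).2 fun p _ => h.eventually_ge_atTop _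
  filter_upwards [h'] with n hn p hp
  rw [Finset.mem_subtype]
  exact Finset.mem_union_left _ (mem_primesLEExp.2 ⟨p.2, hn p hp⟩)

/-- **Theorem 1 (Tóth–Wirsing).** If `f` is a nonnegative multiplicative arithmetic
function, `ρ p = sup_{ν≥0} f(p^ν) < ∞` for all primes `p`, and the product
`R = ∏_p (1-1/p)ρ(p)` converges unconditionally (improper limits allowed, encoded as
`HasProd` in `ℝ≥0∞`), then `limsup f(n)/log log n ≤ e^γ R`. -/
theorem limsup_le_of_unconditional_prod
    (f : ℕ → ℝ) (hf0 : ∀ n, 0 ≤ f n) (hf1 : f 1 = 1)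
    (hfm : ∀ m n : ℕ, Nat.Coprime m n → f (m * n) = f m * f n)
    (ρ : ℕ → ℝ)
    (hρ : ∀ p : ℕ, p.Prime → IsLUB (Set.range fun ν : ℕ => f (p ^ ν)) (ρ p))
    (R : ℝ≥0∞)
    (hR : HasProd (fun p : Nat.Primes =>
      ENNReal.ofReal ((1 - 1 / ((p : ℕ) : ℝ)) * ρ (p : ℕ))) R) :
    Filter.limsup (fun n : ℕ => ENNReal.ofReal (f n / Real.log (Real.log n)))
      Filter.atTop ≤ ENNReal.ofReal (Real.exp Real.eulerMascheroniConstant) * R := by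
  have hρf : ∀ p : ℕ, p.Prime → ∀ ν : ℕ, f (p ^ ν) ≤ ρ p := fun p hp ν => (hρ p hp).1 ⟨ν, rfl⟩
  have hρ1 : ∀ p : ℕ, p.Prime → 1 ≤ ρ p := fun p hp => by simpa [hf1] using hρf p hp 0
  have hfac : ∀ p : ℕ, p.Prime → 0 < 1 - 1 / (p : ℝ) := fun p hp => by
    have hp1 : (1 : ℝ) < p := by exact_mod_cast hp.one_lt
    rw [sub_pos, div_lt_one (by linarith)]
    exact hp1
  have hfle : ∀ n : ℕ, n ≠ 0 → f n ≤ ∏ p ∈ smallOrDividing n, ρ p := fun n hn => by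
    rw [Nat.multiplicative_factorization f hfm hf1 hn, Finsupp.prod, Nat.support_factorization]
    calc ∏ p ∈ n.primeFactors, f (p ^ n.factorization p) ≤ ∏ p ∈ n.primeFactors, ρ p :=
          Finset.prod_le_prod (fun p _ => hf0 _)
            fun p hp => hρf p (Nat.prime_of_mem_primeFactors hp) _
      _ ≤ ∏ p ∈ smallOrDividing n, ρ p := by
          rw [← Finset.prod_sdiff (s₁ := n.primeFactors) (s₂ := smallOrDividing n)
            Finset.subset_union_right]
          refine le_mul_of_one_le_left (Finset.prod_nonneg fun p hp => ?_)
            (Finset.one_le_prod fun p hp => ?_)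
          · exact zero_le_one.trans (hρ1 p (Nat.prime_of_mem_primeFactors hp))
          · exact hρ1 p (prime_of_mem_smallOrDividing (Finset.mem_sdiff.1 hp).1)
  have hprod : Tendsto (fun n : ℕ =>
      ENNReal.ofReal (∏ p ∈ smallOrDividing n, (1 - 1 / (p : ℝ)) * ρ p)) atTop (𝓝 R) := by
    have hR' : Tendsto (fun F : Finset Nat.Primes => ∏ p ∈ F,
        ENNReal.ofReal ((1 - 1 / ((p : ℕ) : ℝ)) * ρ (p : ℕ))) atTop (𝓝 R) := by
      rw [← SummationFilter.unconditional_filter]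
      exact hR
    refine (hR'.comp tendsto_subtype_smallOrDividing).congr fun n => ?_
    rw [ENNReal.ofReal_prod_of_nonneg fun p hp => ?_]
    · exact Finset.prod_subtype_of_mem
        (fun p : ℕ => ENNReal.ofReal ((1 - 1 / (p : ℝ)) * ρ p))
        fun p hp => prime_of_mem_smallOrDividing hp
    · have hp := prime_of_mem_smallOrDividing hp
      exact mul_nonneg (hfac p hp).le (zero_le_one.trans (hρ1 p hp))
  have key : ∀ c : ℝ, exp eulerMascheroniConstant < c →
      limsup (fun n : ℕ => ENNReal.ofReal (f n / log (log n))) atTop ≤ ENNReal.ofReal c * R := by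
    intro c hc
    have hlim := ENNReal.Tendsto.const_mul (a := ENNReal.ofReal c) hprod
      (Or.inr ENNReal.ofReal_ne_top)
    rw [← hlim.limsup_eq]
    refine limsup_le_limsup ?_
    filter_upwards [eventually_prod_smallOrDividing_le hc, eventually_ne_atTop 0,
      tendsto_log_log_natCast.eventually_gt_atTop 0] with n h1 h2 h3
    have h4 : 0 ≤ ∏ p ∈ smallOrDividing n, (1 - 1 / (p : ℝ)) * ρ p :=
      Finset.prod_nonneg fun p hp => by
        have hp := prime_of_mem_smallOrDividing hp
        exact mul_nonneg (hfac p hp).le (zero_le_one.trans (hρ1 p hp))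
    rw [← ENNReal.ofReal_mul ((exp_pos _).trans hc).le]
    refine ENNReal.ofReal_le_ofReal ?_
    rw [div_le_iff₀ h3]
    calc f n ≤ ∏ p ∈ smallOrDividing n, ρ p := hfle n h2
      _ = (∏ p ∈ smallOrDividing n, (1 - 1 / (p : ℝ))⁻¹)
          * ∏ p ∈ smallOrDividing n, (1 - 1 / (p : ℝ)) * ρ p := by
          rw [← Finset.prod_mul_distrib]
          refine Finset.prod_congr rfl fun p hp => ?_
          rw [inv_mul_cancel_left₀ (hfac p (prime_of_mem_smallOrDividing hp)).ne']
      _ ≤ c * log (log n) * ∏ p ∈ smallOrDividing n, (1 - 1 / (p : ℝ)) * ρ p := by gcongr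
      _ = _ := by ring
  have hc : Tendsto (fun c : ℝ => ENNReal.ofReal c * R) (𝓝[>] exp eulerMascheroniConstant)
      (𝓝 (ENNReal.ofReal (exp eulerMascheroniConstant) * R)) :=
    ENNReal.Tendsto.mul_const
      ((ENNReal.continuous_ofReal.tendsto _).mono_left nhdsWithin_le_nhds)
      (Or.inl (ENNReal.ofReal_pos.2 (exp_pos _)).ne')
  refine ge_of_tendsto hc ?_
  filter_upwards [self_mem_nhdsWithin] with c hc
  exact key c hc
end

section
/- Let f be a nonnegative multiplicative arithmetic function with ρ(p) = sup_{ν≥0} f(p^ν) < ∞ for all primes p. Suppose for each prime p there is an exponent e_p ∈ ℕ with e_p = p^{o(1)} (i.e., log e_p / log p → 0) such that ∏_p f(p^{e_p})·ρ(p)^{-1} > 0, and the product R = ∏_p (1-1/p)ρ(p) converges. Then limsup_{n→∞} f(n)/log log n ≥ e^γ · R. -/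
open Filter Real
open scoped ENNReal

section

open MeasureTheory Set Topology

theorem integral_exp_neg_mul_log_Ioi :
    ∫ t in Ioi (0 : ℝ), exp (-t) * log t = -eulerMascheroniConstant := by
  have h1 := Complex.hasDerivAt_GammaIntegral (s := 1) (by simp)
  have h2 : Complex.GammaIntegral =ᶠ[𝓝 1] Complex.Gamma := by
    have ho : IsOpen {s : ℂ | 0 < s.re} := Complex.continuous_re.isOpen_preimage _ isOpen_Ioi
    filter_upwards [ho.mem_nhds (show (0 : ℝ) < (1 : ℂ).re by simp)] with s hs
    exact (Complex.Gamma_eq_integral hs).symm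
  have h3 := (h1.congr_of_eventuallyEq h2.symm).unique Complex.hasDerivAt_Gamma_one
  have h4 : (((∫ t in Ioi (0 : ℝ), exp (-t) * log t) : ℝ) : ℂ)
      = ((-eulerMascheroniConstant : ℝ) : ℂ) := by
    rw [← integral_complex_ofReal]
    push_cast
    rw [← h3]
    refine integral_congr_ae (ae_of_all _ fun t => ?_)
    simp [mul_comm]
  exact_mod_cast h4

theorem integrableOn_exp_neg_mul_log_Ioi :
    IntegrableOn (fun t : ℝ => exp (-t) * log t) (Ioi 0) := by
  refine Integrable.of_integral_ne_zero ?_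
  rw [integral_exp_neg_mul_log_Ioi]
  linarith [one_half_lt_eulerMascheroniConstant]

theorem integrableOn_exp_neg_mul_mul_log_Ioi {δ : ℝ} (hδ : 0 < δ) :
    IntegrableOn (fun v : ℝ => exp (-δ * v) * log v) (Ioi 0) := by
  have h := (integrableOn_Ioi_comp_mul_left_iff (fun t : ℝ => exp (-t) * log t) 0 hδ).2
    (by simpa using integrableOn_exp_neg_mul_log_Ioi)
  refine (h.sub ((integrableOn_exp_mul_Ioi (neg_lt_zero.2 hδ) 0).mul_const (log δ))).congr ?_
  filter_upwards [ae_restrict_mem measurableSet_Ioi] with v hv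
  simp only [Pi.sub_apply, neg_mul]
  rw [log_mul hδ.ne' (ne_of_gt hv)]
  ring

theorem integral_exp_neg_mul_mul_log_Ioi {δ : ℝ} (hδ : 0 < δ) :
    δ * ∫ v in Ioi (0 : ℝ), exp (-δ * v) * log v = -eulerMascheroniConstant - log δ := by
  have h := integral_comp_mul_left_Ioi' (fun t : ℝ => exp (-t) * log t) 0 hδ
  rw [mul_zero, integral_exp_neg_mul_log_Ioi, smul_eq_mul] at h
  have hE := integrableOn_exp_mul_Ioi (neg_lt_zero.2 hδ) 0
  have h2 : ∫ v in Ioi (0 : ℝ), exp (-(δ * v)) * log (δ * v)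
      = (∫ v in Ioi (0 : ℝ), exp (-δ * v) * log v)
        + (∫ v in Ioi (0 : ℝ), exp (-δ * v)) * log δ := by
    rw [← integral_mul_const, ← integral_add (integrableOn_exp_neg_mul_mul_log_Ioi hδ)
      (hE.mul_const _)]
    refine setIntegral_congr_fun measurableSet_Ioi fun v hv => ?_
    simp only [neg_mul]
    rw [log_mul hδ.ne' (ne_of_gt hv)]
    ring
  rw [h2, integral_exp_mul_Ioi (neg_lt_zero.2 hδ)] at h
  simp only [mul_zero, exp_zero] at h
  field_simp at h ⊢
  linarith

/-- The Euler factor at `s = 1 + δ` is controlled by the one at `s = 1`. -/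
theorem neg_log_one_sub_mul_le {x y : ℝ} (hx1 : x < 1) (hy0 : 0 ≤ y) (hy1 : y ≤ 1) :
    -log (1 - y * x) ≤ y * -log (1 - x) := by
  have h := strictConcaveOn_log_Ioi.concaveOn.2 (x := 1 - x) (y := 1) (by simpa using hx1)
    (by simp) hy0 (sub_nonneg.2 hy1) (by ring)
  simp only [smul_eq_mul, log_one, mul_zero, add_zero] at h
  rw [show y * (1 - x) + (1 - y) * 1 = 1 - y * x by ring] at h
  linarith

open Finset in
/-- A bound `B` for the partial sums of `g` gives a bound for the Dirichlet series
of `g` with frequencies `l` by the Laplace transform of `B`. -/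
theorem sum_mul_exp_neg_le_integral {s : Finset ℕ} {g l : ℕ → ℝ} (hl : ∀ p ∈ s, 0 ≤ l p)
    {B : ℝ → ℝ} {δ : ℝ} (hδ : 0 < δ) (hB : ∀ v, 0 < v → ∑ p ∈ s with l p < v, g p ≤ B v)
    (hBi : IntegrableOn (fun v => exp (-δ * v) * B v) (Set.Ioi 0)) :
    ∑ p ∈ s, g p * exp (-δ * l p) ≤ δ * ∫ v in Set.Ioi (0 : ℝ), exp (-δ * v) * B v := by
  have hE := fun c : ℝ => integrableOn_exp_mul_Ioi (neg_lt_zero.2 hδ) c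
  have hterm : ∀ p ∈ s, g p * exp (-δ * l p) =
      δ * ∫ v in Set.Ioi (0 : ℝ), g p * (Set.Ioi (l p)).indicator (fun v => exp (-δ * v)) v := by
    intro p hp
    rw [integral_const_mul, setIntegral_indicator measurableSet_Ioi, Set.Ioi_inter_Ioi,
      sup_eq_right.2 (hl p hp), integral_exp_mul_Ioi (neg_lt_zero.2 hδ)]
    field_simp
  have hint : ∀ p ∈ s, IntegrableOn
      (fun v => g p * (Set.Ioi (l p)).indicator (fun v => exp (-δ * v)) v) (Set.Ioi 0) :=
    fun p _ => ((hE 0).indicator measurableSet_Ioi).const_mul _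
  rw [sum_congr rfl hterm, ← mul_sum, ← integral_finsetSum _ hint]
  refine mul_le_mul_of_nonneg_left (setIntegral_mono_on (integrable_finsetSum _ hint) hBi
    measurableSet_Ioi fun v hv => ?_) hδ.le
  calc _ = exp (-δ * v) * ∑ p ∈ s with l p < v, g p := by
        rw [sum_filter, mul_sum]
        refine sum_congr rfl fun p _ => ?_
        by_cases h : l p < v <;> simp [h, mul_comm]
    _ ≤ _ := mul_le_mul_of_nonneg_left (hB v hv) (exp_pos _).le

/-- The reciprocal power function as a completely multiplicative function. -/
noncomputable def natRpowNegHom {s : ℝ} (hs : 0 < s) : ℕ →*₀ ℝ where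
  toFun n := (n : ℝ) ^ (-s)
  map_zero' := by simp [zero_rpow (neg_ne_zero.2 hs.ne')]
  map_one' := by simp
  map_mul' m n := by push_cast; exact mul_rpow m.cast_nonneg n.cast_nonneg

theorem tendsto_prod_primesBelow_one_sub_rpow_inv {s : ℝ} (hs : 1 < s) :
    Tendsto (fun n : ℕ => ∏ p ∈ n.primesBelow, (1 - (p : ℝ) ^ (-s))⁻¹) atTop
      (𝓝 (∑' n : ℕ, 1 / (n : ℝ) ^ s)) := by
  have hsum : Summable (fun n : ℕ => ‖natRpowNegHom (zero_lt_one.trans hs) n‖) :=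
    (summable_nat_rpow.2 (neg_lt_neg hs)).norm
  simp_rw [one_div, ← rpow_neg (Nat.cast_nonneg _)]
  exact EulerProduct.eulerProduct_completely_multiplicative hsum

theorem neg_log_one_sub_one_div_prime_nonneg {p : ℕ} (hp : p.Prime) :
    0 ≤ -log (1 - 1 / (p : ℝ)) := by
  have h2 : (2 : ℝ) ≤ p := mod_cast hp.two_le
  have h : 1 / (p : ℝ) ≤ 1 / 2 := one_div_le_one_div_of_le two_pos h2
  have h' : 0 < 1 / (p : ℝ) := by positivity
  exact neg_nonneg.2 (log_nonpos (by linarith) (by linarith))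

open Finset in
/-- If the partial sums of `-log (1 - 1 / p)` are bounded by `B (log x)`, then the Laplace transform
of `B` controls the zeta function. -/
theorem tsum_one_div_rpow_le_exp {B : ℝ → ℝ} {δ : ℝ} (hδ : 0 < δ)
    (hB : ∀ n : ℕ, ∀ v, 0 < v →
      ∑ p ∈ n.primesBelow with log (p : ℕ) < v, -log (1 - 1 / (p : ℝ)) ≤ B v)
    (hBi : IntegrableOn (fun v => exp (-δ * v) * B v) (Set.Ioi 0)) :
    ∑' n : ℕ, 1 / (n : ℝ) ^ (1 + δ) ≤ exp (δ * ∫ v in Set.Ioi (0 : ℝ), exp (-δ * v) * B v) := by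
  refine le_of_tendsto' (tendsto_prod_primesBelow_one_sub_rpow_inv (by linarith)) fun n => ?_
  have key := sum_mul_exp_neg_le_integral (s := n.primesBelow)
    (g := fun p => -log (1 - 1 / (p : ℝ))) (l := fun p => log p)
    (fun p _ => log_natCast_nonneg p) hδ (hB n) hBi
  refine le_trans ?_ (exp_le_exp.2 key)
  rw [exp_sum]
  have hpos : ∀ p ∈ n.primesBelow, 0 < 1 - (p : ℝ) ^ (-(1 + δ)) := by
    intro p hp
    have h1 : (1 : ℝ) < p := mod_cast (Nat.prime_of_mem_primesBelow hp).one_lt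
    linarith [rpow_lt_one_of_one_lt_of_neg h1 (show -(1 + δ) < 0 by linarith)]
  refine prod_le_prod (fun p hp => (inv_pos.2 (hpos p hp)).le) fun p hp => ?_
  have h1 : (1 : ℝ) < p := mod_cast (Nat.prime_of_mem_primesBelow hp).one_lt
  have h0 : (0 : ℝ) < p := by linarith
  rw [← exp_log (hpos p hp), ← exp_neg, exp_le_exp]
  have hE : exp (-δ * log p) = (p : ℝ) ^ (-δ) := by rw [rpow_def_of_pos h0, mul_comm]
  have h := neg_log_one_sub_mul_le (x := 1 / (p : ℝ)) (y := (p : ℝ) ^ (-δ))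
    ((div_lt_one h0).2 h1) (rpow_nonneg h0.le _)
    (rpow_le_one_of_one_le_of_nonpos h1.le (by linarith))
  rw [hE, mul_comm]
  convert h using 4
  rw [neg_add, add_comm, rpow_add h0, rpow_neg_one, one_div]

open Finset in
/-- The lower bound in Mertens' third theorem, along an unbounded sequence. -/
theorem frequently_log_log_add_eulerMascheroni_le {ε : ℝ} (hε : 0 < ε) :
    ∃ᶠ N : ℕ in atTop, log (log N) + eulerMascheroniConstant - ε ≤
      ∑ p ∈ (range (N + 1)).filter Nat.Prime, -log (1 - 1 / (p : ℝ)) := by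
  intro hcon
  obtain ⟨N₁, hN₁⟩ := eventually_atTop.1 hcon
  set N₀ := max N₁ 3
  set c := eulerMascheroniConstant - ε
  set G : ℕ → ℝ := fun N => ∑ p ∈ (range (N + 1)).filter Nat.Prime, -log (1 - 1 / (p : ℝ))
  have hG : ∀ N, N₀ ≤ N → G N ≤ log (log N) + c := fun N hN => by
    have := hN₁ N ((le_max_left _ _).trans hN)
    simp only [G, c]
    linarith
  have hsub : ∀ (n N : ℕ) (v : ℝ), (∀ p : ℕ, p.Prime → log p < v → p ≤ N) →
      ∑ p ∈ n.primesBelow with log (p : ℕ) < v, -log (1 - 1 / (p : ℝ)) ≤ G N := by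
    intro n N v h
    refine sum_le_sum_of_subset_of_nonneg (fun p hp => ?_)
      fun p hp _ => neg_log_one_sub_one_div_prime_nonneg (mem_filter.1 hp).2
    rw [mem_filter] at hp
    have hpp := Nat.prime_of_mem_primesBelow hp.1
    exact mem_filter.2 ⟨mem_range.2 (Nat.lt_succ_of_le (h p hpp hp.2)), hpp⟩
  set T := log N₀
  have hN₀ : (3 : ℝ) ≤ N₀ := mod_cast le_max_right _ _
  have hT : 0 < T := log_pos (by linarith)
  set K : ℝ → ℝ := fun v => |G N₀| + |c| + |log v|
  set B : ℝ → ℝ := fun v => log v + c + (Set.Iic T).indicator K v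
  have hB : ∀ n : ℕ, ∀ v, 0 < v →
      ∑ p ∈ n.primesBelow with log (p : ℕ) < v, -log (1 - 1 / (p : ℝ)) ≤ B v := by
    intro n v hv
    by_cases hvT : v ≤ T
    · refine (hsub n N₀ v fun p hp hpv => ?_).trans ?_
      · have := (log_lt_log_iff (by exact_mod_cast hp.pos) (by linarith)).1 (hpv.trans_le hvT)
        exact_mod_cast this.le
      · simp only [B, K, Set.indicator_of_mem (Set.mem_Iic.2 hvT)]
        linarith [le_abs_self (G N₀), neg_abs_le c, neg_abs_le (log v)]
    · push Not at hvT
      have hNv : N₀ ≤ ⌊exp v⌋₊ := by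
        refine Nat.le_floor ?_
        rw [← exp_log (show (0 : ℝ) < N₀ by linarith)]
        exact exp_le_exp.2 hvT.le
      refine (hsub n ⌊exp v⌋₊ v fun p hp hpv => ?_).trans ((hG _ hNv).trans ?_)
      · refine Nat.le_floor ?_
        rw [← exp_log (show (0 : ℝ) < p by exact_mod_cast hp.pos)]
        exact exp_le_exp.2 hpv.le
      · simp only [B, Set.indicator_of_notMem (show v ∉ Set.Iic T from not_le.2 hvT), add_zero]
        have h3 : (3 : ℝ) ≤ ⌊exp v⌋₊ := hN₀.trans (by exact_mod_cast hNv)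
        have h4 : log ⌊exp v⌋₊ ≤ v := by
          rw [log_le_iff_le_exp (by linarith)]
          exact Nat.floor_le (exp_pos v).le
        have := log_le_log (log_pos (by linarith)) h4
        linarith
  have hKi : IntegrableOn K (Set.Ioc 0 T) := by
    have : IntegrableOn log (Set.Ioc 0 T) :=
      (intervalIntegrable_iff_integrableOn_Ioc_of_le hT.le).1 intervalIntegral.intervalIntegrable_log'
    exact (integrableOn_const (by simp)).add this.abs
  set A := ∫ v in Set.Ioc 0 T, K v
  have hK0 : ∀ v, 0 ≤ K v := fun v => by positivity
  have hbound : ∀ δ : ℝ, 0 < δ →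
      δ * ∑' n : ℕ, 1 / (n : ℝ) ^ (1 + δ) ≤ exp (-ε + δ * A) := by
    intro δ hδ
    have hE := integrableOn_exp_mul_Ioi (neg_lt_zero.2 hδ) 0
    have hL := integrableOn_exp_neg_mul_mul_log_Ioi hδ
    have hle : ∀ v ∈ Set.Ioc 0 T, exp (-δ * v) * K v ≤ K v := fun v hv =>
      mul_le_of_le_one_left (hK0 v) (exp_le_one_iff.2 (by nlinarith [hv.1]))
    have hEK : IntegrableOn (fun v => exp (-δ * v) * K v) (Set.Ioc 0 T) := by
      refine Integrable.mono' hKi ?_ ?_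
      · exact (Continuous.aestronglyMeasurable (by fun_prop)).mul hKi.1
      · filter_upwards [ae_restrict_mem measurableSet_Ioc] with v hv
        rw [norm_of_nonneg (mul_nonneg (exp_pos _).le (hK0 v))]
        exact hle v hv
    have hEK' : IntegrableOn ((Set.Iic T).indicator fun v => exp (-δ * v) * K v) (Set.Ioi 0) := by
      rw [IntegrableOn, integrable_indicator_iff measurableSet_Iic, IntegrableOn,
        Measure.restrict_restrict measurableSet_Iic, Set.inter_comm, Set.Ioi_inter_Iic]
      exact hEK
    have hBeq : (fun v => exp (-δ * v) * B v) = fun v => (exp (-δ * v) * log v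
        + exp (-δ * v) * c) + (Set.Iic T).indicator (fun v => exp (-δ * v) * K v) v := by
      ext v
      by_cases h : v ∈ Set.Iic T <;> simp only [B, h, Set.indicator_of_mem, not_false_eq_true,
        Set.indicator_of_notMem] <;> ring
    have hBi : IntegrableOn (fun v => exp (-δ * v) * B v) (Set.Ioi 0) := by
      rw [hBeq]
      exact (hL.add (hE.mul_const c)).add hEK'
    have hint : δ * ∫ v in Set.Ioi (0 : ℝ), exp (-δ * v) * B v ≤ -log δ - ε + δ * A := by
      have hLc : IntegrableOn (fun v => exp (-δ * v) * log v + exp (-δ * v) * c) (Set.Ioi 0) :=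
        hL.add (hE.mul_const c)
      rw [hBeq, integral_add hLc hEK', integral_add hL (hE.mul_const c),
        integral_mul_const, integral_exp_mul_Ioi (neg_lt_zero.2 hδ),
        setIntegral_indicator measurableSet_Iic, Set.Ioi_inter_Iic, mul_add, mul_add,
        integral_exp_neg_mul_mul_log_Ioi hδ]
      have h1 : ∫ v in Set.Ioc 0 T, exp (-δ * v) * K v ≤ A :=
        setIntegral_mono_on hEK hKi measurableSet_Ioc hle
      have h2 := mul_le_mul_of_nonneg_left h1 hδ.le
      have h3 : δ * (-exp (-δ * 0) / -δ * c) = c := by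
        simp only [mul_zero, exp_zero]; field_simp
      rw [h3]
      simp only [c]
      linarith
    calc δ * ∑' n : ℕ, 1 / (n : ℝ) ^ (1 + δ) ≤ δ * exp (-log δ - ε + δ * A) := by
          gcongr
          exact (tsum_one_div_rpow_le_exp hδ hB hBi).trans (exp_le_exp.2 hint)
      _ = exp (-ε + δ * A) := by
          conv_lhs => rw [← exp_log hδ, ← exp_add, exp_log hδ]
          ring_nf
  have hlim : Tendsto (fun δ : ℝ => δ * ∑' n : ℕ, 1 / (n : ℝ) ^ (1 + δ)) (𝓝[>] 0) (𝓝 1) := by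
    have hshift : Tendsto (fun δ : ℝ => 1 + δ) (𝓝[>] 0) (𝓝[>] 1) := by
      refine tendsto_nhdsWithin_iff.2 ⟨?_, ?_⟩
      · exact (Continuous.tendsto' (by fun_prop) _ _ (by simp)).mono_left nhdsWithin_le_nhds
      · filter_upwards [self_mem_nhdsWithin] with δ hδ
        simpa using hδ
    simpa [Function.comp_def] using tendsto_sub_mul_tsum_nat_rpow.comp hshift
  have hlim' : Tendsto (fun δ : ℝ => exp (-ε + δ * A)) (𝓝[>] 0) (𝓝 (exp (-ε))) :=
    (Continuous.tendsto' (by fun_prop) _ _ (by simp)).mono_left nhdsWithin_le_nhds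
  have := le_of_tendsto_of_tendsto hlim hlim' (by
    filter_upwards [self_mem_nhdsWithin] with δ hδ using hbound δ hδ)
  linarith [Real.exp_lt_one_iff.2 (neg_lt_zero.2 hε)]

open Finset in
theorem map_prod_prime_pow {M : Type*} [CommMonoid M] {f : ℕ → M} (hf1 : f 1 = 1)
    (hfm : ∀ m n : ℕ, Nat.Coprime m n → f (m * n) = f m * f n) (a : ℕ → ℕ) {s : Finset ℕ}
    (hs : ∀ p ∈ s, p.Prime) : f (∏ p ∈ s, p ^ a p) = ∏ p ∈ s, f (p ^ a p) := by
  induction s using Finset.induction_on with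
  | empty => simpa using hf1
  | insert q s hq ih =>
    rw [prod_insert hq, prod_insert hq, hfm, ih fun p hp => hs p (mem_insert_of_mem hp)]
    refine Nat.Coprime.prod_right fun p hp => Nat.Coprime.pow _ _ ?_
    refine (Nat.coprime_primes (hs q (mem_insert_self _ _)) (hs p (mem_insert_of_mem hp))).2 ?_
    rintro rfl
    exact hq hp

open Finset in
/-- Exponents which are nearly optimal at small primes and equal to `e` at large primes. -/
theorem exists_exponents_prod_ge {f : ℕ → ℝ} (hf0 : ∀ n, 0 ≤ f n) {ρ : ℕ → ℝ}
    (hρ0 : ∀ p : ℕ, p.Prime → 0 < ρ p)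
    (hρ : ∀ p : ℕ, p.Prime → IsLUB (Set.range fun ν : ℕ => f (p ^ ν)) (ρ p))
    {e : ℕ → ℕ} {P : ℝ} (hPpos : 0 < P)
    (hP : Tendsto (fun N : ℕ => ∏ p ∈ (range N).filter Nat.Prime, f (p ^ e p) / ρ p)
      atTop (𝓝 P)) {ε : ℝ} (hε : 0 < ε) :
    ∃ a : ℕ → ℕ, (∀ᶠ p in atTop, a p = e p) ∧
      ∀ᶠ N in atTop, exp (-ε) * ∏ p ∈ (range N).filter Nat.Prime, ρ p ≤
        ∏ p ∈ (range N).filter Nat.Prime, f (p ^ a p) := by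
  have hlo : P * exp (-(ε / 4)) < P := mul_lt_of_lt_one_right hPpos
    (Real.exp_lt_one_iff.2 (by linarith))
  have hhi : P < P * exp (ε / 4) := lt_mul_of_one_lt_right hPpos (one_lt_exp_iff.2 (by linarith))
  obtain ⟨y, hy⟩ := eventually_atTop.1 (hP.eventually (Ioo_mem_nhds hlo hhi))
  set η := exp (-(ε / (2 * (y + 1))))
  have hη : η < 1 := Real.exp_lt_one_iff.2 (by rw [neg_lt_zero]; positivity)
  have hν : ∀ p : ℕ, ∃ ν : ℕ, p.Prime → η * ρ p < f (p ^ ν) := by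
    intro p
    by_cases hp : p.Prime
    · obtain ⟨_, ⟨ν, rfl⟩, h⟩ := (lt_isLUB_iff (hρ p hp)).1
        (mul_lt_of_lt_one_left (hρ0 p hp) hη)
      exact ⟨ν, fun _ => h⟩
    · exact ⟨0, fun h => absurd h hp⟩
  choose ν hν using hν
  refine ⟨fun p => if p < y then ν p else e p, ?_, ?_⟩
  · filter_upwards [eventually_ge_atTop y] with p hp
    simp [hp]
  filter_upwards [eventually_ge_atTop y] with N hN
  set a : ℕ → ℕ := fun p => if p < y then ν p else e p
  set k : ℕ → ℝ := fun p => if p.Prime then f (p ^ e p) / ρ p else 1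
  set h : ℕ → ℝ := fun p => if p.Prime then f (p ^ a p) / ρ p else 1
  have hk0 : ∀ p, 0 ≤ k p := fun p => by
    by_cases hp : p.Prime
    · simpa [k, hp] using div_nonneg (hf0 _) (hρ0 p hp).le
    · simp [k, hp]
  have hsplit : ∏ p ∈ range N, h p = (∏ p ∈ range y, h p) * ∏ p ∈ Ico y N, k p := by
    rw [← prod_range_mul_prod_Ico h hN]
    congr 1
    refine prod_congr rfl fun p hp => ?_
    simp [h, k, show a p = e p from if_neg (not_lt.2 (mem_Ico.1 hp).1)]
  have hsmall : exp (-(ε / 2)) ≤ ∏ p ∈ range y, h p := by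
    have h1 : ∏ _p ∈ range y, η ≤ ∏ p ∈ range y, h p := by
      refine prod_le_prod (fun _ _ => (exp_pos _).le) fun p hp => ?_
      by_cases hpp : p.Prime
      · simp only [h, hpp, if_true, a, mem_range.1 hp]
        exact ((le_div_iff₀ (hρ0 p hpp)).2 (hν p hpp).le)
      · simpa [h, hpp] using hη.le
    refine le_trans ?_ h1
    rw [prod_const, card_range, ← exp_nat_mul, exp_le_exp]
    have : (y : ℝ) * -(ε / (2 * (y + 1))) = -(ε / 2) * (y / (y + 1)) := by field_simp
    rw [this]
    have h2 : (y : ℝ) / (y + 1) ≤ 1 := (div_le_one (by positivity)).2 (by linarith)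
    nlinarith
  have hlarge : exp (-(ε / 2)) ≤ ∏ p ∈ Ico y N, k p := by
    have h1 := (hy N hN).1
    have h2 := (hy y le_rfl).2
    simp only [prod_filter] at h1 h2
    change _ < ∏ p ∈ range N, k p at h1
    change ∏ p ∈ range y, k p < _ at h2
    rw [← prod_range_mul_prod_Ico k hN] at h1
    have hI : 0 ≤ ∏ p ∈ Ico y N, k p := prod_nonneg fun p _ => hk0 p
    have h3 : P * exp (-(ε / 4)) ≤ P * (exp (ε / 4) * ∏ p ∈ Ico y N, k p) := by
      rw [← mul_assoc]
      exact h1.le.trans (mul_le_mul_of_nonneg_right h2.le hI)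
    have h4 := le_of_mul_le_mul_left h3 hPpos
    have h5 : exp (-(ε / 4)) = exp (ε / 4) * exp (-(ε / 2)) := by
      rw [← exp_add]; ring_nf
    rw [h5] at h4
    exact le_of_mul_le_mul_left h4 (exp_pos _)
  have hprod : exp (-ε) ≤ ∏ p ∈ (range N).filter Nat.Prime, f (p ^ a p) / ρ p := by
    rw [prod_filter]
    change _ ≤ ∏ p ∈ range N, h p
    rw [hsplit, show -ε = -(ε / 2) + -(ε / 2) by ring, exp_add]
    exact mul_le_mul hsmall hlarge (exp_pos _).le ((exp_pos _).le.trans hsmall)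
  rw [prod_div_distrib, le_div_iff₀ (prod_pos fun p hp => hρ0 p (mem_filter.1 hp).2)] at hprod
  exact hprod

open Finset in
theorem tendsto_prod_prime_pow_atTop {a : ℕ → ℕ} (ha : ∀ᶠ p in atTop, p.Prime → 0 < a p) :
    Tendsto (fun N : ℕ => ∏ p ∈ (range (N + 1)).filter Nat.Prime, p ^ a p) atTop atTop := by
  obtain ⟨y, hy⟩ := eventually_atTop.1 ha
  refine tendsto_atTop.2 fun b => ?_
  obtain ⟨q, hq, hqp⟩ := Nat.exists_infinite_primes (max b y)
  filter_upwards [eventually_ge_atTop q] with N hN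
  refine ((le_max_left _ _).trans hq).trans (Nat.le_of_dvd ?_ ?_)
  · exact prod_pos fun p hp => pow_pos (mem_filter.1 hp).2.pos _
  · exact (dvd_pow_self q (hy q ((le_max_right _ _).trans hq) hqp).ne').trans
      (dvd_prod_of_mem (fun p => p ^ a p)
        (mem_filter.2 ⟨mem_range.2 (Nat.lt_succ_of_le hN), hqp⟩))

open Finset in
theorem eventually_log_log_prod_prime_pow_le {a : ℕ → ℕ} {ε : ℝ} (hε : 0 < ε)
    (ha : ∀ᶠ p : ℕ in atTop, p.Prime → log (a p) ≤ ε / 4 * log p) :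
    ∀ᶠ N : ℕ in atTop,
      log (log ((∏ p ∈ (range (N + 1)).filter Nat.Prime, p ^ a p : ℕ) : ℝ)) ≤
        (1 + ε) * log N := by
  obtain ⟨z, hz⟩ := eventually_atTop.1 ha
  set C : ℝ := 1 + ∑ p ∈ range z, (a p : ℝ)
  have hC : 1 ≤ C := le_add_of_nonneg_right (sum_nonneg fun _ _ => Nat.cast_nonneg _)
  set D : ℝ := 8 * C / ε
  have hD : 0 < D := by positivity
  have hlogN : Tendsto (fun N : ℕ => log (N : ℝ)) atTop atTop :=
    tendsto_log_atTop.comp tendsto_natCast_atTop_atTop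
  filter_upwards [eventually_ge_atTop 1, hlogN.eventually_ge_atTop (2 / ε * log D)] with N hN hND
  have hN1 : (1 : ℝ) ≤ N := mod_cast hN
  have hN0 : (0 : ℝ) < N := by linarith
  have hNε : 1 ≤ (N : ℝ) ^ (ε / 4) := one_le_rpow hN1 (by positivity)
  have haN : ∀ p ∈ (range (N + 1)).filter Nat.Prime, (a p : ℝ) ≤ C * (N : ℝ) ^ (ε / 4) := by
    intro p hp
    obtain ⟨hpN, hpp⟩ := mem_filter.1 hp
    have hpN' : (p : ℝ) ≤ N := by exact_mod_cast Nat.le_of_lt_succ (mem_range.1 hpN)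
    have hp0 : (0 : ℝ) < p := mod_cast hpp.pos
    by_cases hpz : p < z
    · have h1 : (a p : ℝ) ≤ C := by
        have := single_le_sum (f := fun p => (a p : ℝ)) (fun _ _ => Nat.cast_nonneg _)
          (mem_range.2 hpz)
        simp only [C]; linarith
      exact h1.trans (le_mul_of_one_le_right (by linarith) hNε)
    · have h1 : (a p : ℝ) ≤ (p : ℝ) ^ (ε / 4) := by
        rcases Nat.eq_zero_or_pos (a p) with h0 | h0
        · rw [h0]; simpa using rpow_nonneg hp0.le _
        · rw [← log_le_log_iff (by exact_mod_cast h0) (rpow_pos_of_pos hp0 _), log_rpow hp0]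
          exact hz p (not_lt.1 hpz) hpp
      have h2 : (p : ℝ) ^ (ε / 4) ≤ (N : ℝ) ^ (ε / 4) := rpow_le_rpow hp0.le hpN' (by positivity)
      exact (h1.trans h2).trans (le_mul_of_one_le_left (by positivity) hC)
  have hlogprod : log ((∏ p ∈ (range (N + 1)).filter Nat.Prime, p ^ a p : ℕ) : ℝ) ≤
      D * (N : ℝ) ^ (1 + ε / 2) := by
    push_cast
    rw [log_prod fun p hp => pow_ne_zero _ (by exact_mod_cast (mem_filter.1 hp).2.ne_zero)]
    calc ∑ p ∈ (range (N + 1)).filter Nat.Prime, log ((p : ℝ) ^ a p)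
        ≤ ∑ p ∈ (range (N + 1)).filter Nat.Prime, C * (N : ℝ) ^ (ε / 4) * log N := by
          refine sum_le_sum fun p hp => ?_
          rw [log_pow]
          obtain ⟨hpN, hpp⟩ := mem_filter.1 hp
          exact mul_le_mul (haN p hp) (log_le_log (by exact_mod_cast hpp.pos)
            (by exact_mod_cast Nat.le_of_lt_succ (mem_range.1 hpN)))
            (log_natCast_nonneg p) (by positivity)
      _ ≤ (N + 1 : ℝ) * (C * (N : ℝ) ^ (ε / 4) * log N) := by
          rw [sum_const, nsmul_eq_mul]
          refine mul_le_mul_of_nonneg_right ?_ (mul_nonneg (by positivity) (log_natCast_nonneg N))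
          have := card_filter_le (range (N + 1)) Nat.Prime
          rw [card_range] at this
          exact_mod_cast this
      _ ≤ (2 * N) * (C * (N : ℝ) ^ (ε / 4) * ((N : ℝ) ^ (ε / 4) / (ε / 4))) := by
          gcongr
          · linarith
          · exact log_le_rpow_div hN0.le (by positivity)
      _ = D * (N : ℝ) ^ (1 + ε / 2) := by
          rw [rpow_add hN0, rpow_one, show ε / 2 = ε / 4 + ε / 4 by ring, rpow_add hN0]
          simp only [D]; field_simp; ring
  rcases (log_natCast_nonneg (∏ p ∈ (range (N + 1)).filter Nat.Prime, p ^ a p)).eq_or_lt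
    with h0 | h0
  · rw [← h0, log_zero]
    exact mul_nonneg (by positivity) (log_natCast_nonneg N)
  · have h1 := log_le_log h0 hlogprod
    rw [log_mul hD.ne' (rpow_pos_of_pos hN0 _).ne', log_rpow hN0] at h1
    have h2 : log D ≤ ε / 2 * log N := by
      have := mul_le_mul_of_nonneg_left hND (show 0 ≤ ε / 2 by positivity)
      rwa [← mul_assoc, show ε / 2 * (2 / ε) = 1 by field_simp, one_mul] at this
    linarith

end

/-- **Theorem 3 (Tóth–Wirsing).** If `f` is a nonnegative multiplicative arithmetic
function, `ρ p = sup_{ν≥0} f(p^ν) < ∞` for all primes `p`, for each prime `p` there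
is an exponent `e p ∈ ℕ` with `e p = p^{o(1)}` such that `∏_p f(p^{e p}) ρ(p)⁻¹ > 0`
(the ordered product converges to a positive limit), and the product
`R = ∏_p (1-1/p)ρ(p)` converges (improper limits allowed, encoded in `ℝ≥0∞`), then
`limsup f(n)/log log n ≥ e^γ R`. -/
theorem limsup_ge_of_prod
    (f : ℕ → ℝ) (hf0 : ∀ n, 0 ≤ f n) (hf1 : f 1 = 1)
    (hfm : ∀ m n : ℕ, Nat.Coprime m n → f (m * n) = f m * f n)
    (ρ : ℕ → ℝ)
    (hρ : ∀ p : ℕ, p.Prime → IsLUB (Set.range fun ν : ℕ => f (p ^ ν)) (ρ p))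
    (e : ℕ → ℕ) (he_pos : ∀ p : ℕ, p.Prime → 0 < e p)
    (he : Filter.Tendsto (fun p : ℕ => Real.log (e p) / Real.log p)
      (Filter.atTop ⊓ Filter.principal {p : ℕ | p.Prime}) (nhds 0))
    (P : ℝ) (hPpos : 0 < P)
    (hP : Filter.Tendsto (fun N : ℕ => ∏ p ∈ (Finset.range N).filter Nat.Prime,
      f (p ^ e p) / ρ p) Filter.atTop (nhds P))
    (R : ℝ≥0∞)
    (hR : Filter.Tendsto (fun N : ℕ => ∏ p ∈ (Finset.range N).filter Nat.Prime,
      ENNReal.ofReal ((1 - 1 / (p : ℝ)) * ρ p)) Filter.atTop (nhds R)) :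
    ENNReal.ofReal (Real.exp Real.eulerMascheroniConstant) * R ≤
      Filter.limsup (fun n : ℕ => ENNReal.ofReal (f n / Real.log (Real.log n)))
        Filter.atTop := by
  have hρ0 : ∀ p : ℕ, p.Prime → 0 < ρ p := fun p hp =>
    zero_lt_one.trans_le ((hρ p hp).1 ⟨0, by simpa using hf1⟩)
  refine ENNReal.mul_le_of_forall_lt fun c hc r hr => ?_
  lift c to NNReal using hc.ne_top
  lift r to NNReal using hr.ne_top
  have hc' : (c : ℝ) < exp eulerMascheroniConstant := by
    rw [← ENNReal.ofReal_coe_nnreal] at hc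
    exact (ENNReal.ofReal_lt_ofReal_iff (exp_pos _)).1 hc
  obtain ⟨ε, hcε, hε⟩ : ∃ ε : ℝ,
      (c : ℝ) * (1 + ε) < exp (eulerMascheroniConstant - 2 * ε) ∧ 0 < ε := by
    have h1 : Tendsto (fun ε : ℝ => (c : ℝ) * (1 + ε)) (nhdsWithin 0 (Set.Ioi 0)) (nhds c) :=
      (Continuous.tendsto' (by fun_prop) _ _ (by simp)).mono_left nhdsWithin_le_nhds
    have h2 : Tendsto (fun ε : ℝ => exp (eulerMascheroniConstant - 2 * ε))
        (nhdsWithin 0 (Set.Ioi 0)) (nhds (exp eulerMascheroniConstant)) :=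
      (Continuous.tendsto' (by fun_prop) _ _ (by simp)).mono_left nhdsWithin_le_nhds
    exact ((h1.eventually_lt h2 hc').and self_mem_nhdsWithin).exists
  obtain ⟨a, hae, ha⟩ := exists_exponents_prod_ge hf0 hρ0 hρ hPpos hP hε
  have ha_pos : ∀ᶠ p in atTop, p.Prime → 0 < a p :=
    hae.mono fun p h hp => h ▸ he_pos p hp
  have ha_log : ∀ᶠ p : ℕ in atTop, p.Prime → log (a p) ≤ ε / 4 * log p := by
    have h := he.eventually (gt_mem_nhds (show 0 < ε / 4 by positivity))
    rw [eventually_inf_principal] at h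
    filter_upwards [h, hae] with p hp hpe hpp
    rw [hpe]
    exact ((div_lt_iff₀ (log_pos (by exact_mod_cast hpp.one_lt))).1 (hp hpp)).le
  set n : ℕ → ℕ := fun N => ∏ p ∈ (Finset.range (N + 1)).filter Nat.Prime, p ^ a p
  have hn : Tendsto n atTop atTop := tendsto_prod_prime_pow_atTop ha_pos
  have hloglog : Tendsto (fun N => log (log (n N : ℝ))) atTop atTop :=
    tendsto_log_atTop.comp (tendsto_log_atTop.comp (tendsto_natCast_atTop_atTop.comp hn))
  refine le_limsup_of_frequently_le (hn.frequently ?_) (by isBoundedDefault)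
  have hshift := tendsto_add_atTop_nat 1
  refine ((frequently_log_log_add_eulerMascheroni_le hε).and_eventually
    (((hshift.eventually ha).and (eventually_log_log_prod_prime_pow_le hε ha_log)).and
      (((hR.comp hshift).eventually (lt_mem_nhds hr)).and
        ((hloglog.eventually_gt_atTop 0).and (eventually_ge_atTop 2))))).mono ?_
  rintro N ⟨hM, ⟨hf, hlog⟩, hRN, hpos, hN⟩
  set S := (Finset.range (N + 1)).filter Nat.Prime
  have hSp : ∀ p ∈ S, p.Prime := fun p hp => (Finset.mem_filter.1 hp).2
  have hlogN : 0 < log (N : ℝ) := log_pos (by exact_mod_cast hN)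
  have hfac : ∀ p ∈ S, 0 < 1 - 1 / (p : ℝ) := fun p hp => by
    have h1 : (1 : ℝ) < p := mod_cast (hSp p hp).one_lt
    exact sub_pos.2 ((div_lt_one (by linarith)).2 h1)
  have hr' : (r : ℝ) ≤ (∏ p ∈ S, (1 - 1 / (p : ℝ))) * ∏ p ∈ S, ρ p := by
    rw [← Finset.prod_mul_distrib]
    have h0 : ∀ p ∈ S, 0 ≤ (1 - 1 / (p : ℝ)) * ρ p := fun p hp =>
      mul_nonneg (hfac p hp).le (hρ0 p (hSp p hp)).le
    have h1 : (r : ℝ≥0∞) < ∏ p ∈ S, ENNReal.ofReal ((1 - 1 / (p : ℝ)) * ρ p) := hRN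
    rw [← ENNReal.ofReal_prod_of_nonneg h0, ← ENNReal.ofReal_coe_nnreal] at h1
    exact (ENNReal.ofReal_lt_ofReal_iff_of_nonneg r.coe_nonneg).1 h1 |>.le
  have hmertens : exp (eulerMascheroniConstant - ε) * log N * ∏ p ∈ S, (1 - 1 / (p : ℝ)) ≤ 1 := by
    have h1 : exp (∑ p ∈ S, -log (1 - 1 / (p : ℝ))) * ∏ p ∈ S, (1 - 1 / (p : ℝ)) = 1 := by
      rw [exp_sum, ← Finset.prod_mul_distrib]
      refine Finset.prod_eq_one fun p hp => ?_
      rw [exp_neg, exp_log (hfac p hp), inv_mul_cancel₀ (hfac p hp).ne']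
    refine le_of_le_of_eq ?_ h1
    refine mul_le_mul_of_nonneg_right ?_ (Finset.prod_nonneg fun p hp => (hfac p hp).le)
    rw [← exp_log hlogN, ← exp_add, exp_le_exp]
    linarith
  have hfn : exp (-ε) * ∏ p ∈ S, ρ p ≤ f (n N) := by
    rw [map_prod_prime_pow hf1 hfm a hSp]
    exact hf
  have hρS : 0 ≤ ∏ p ∈ S, ρ p := Finset.prod_nonneg fun p hp => (hρ0 p (hSp p hp)).le
  have hmain : (c : ℝ) * r ≤ f (n N) / log (log (n N)) := by
    rw [le_div_iff₀ hpos]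
    calc (c : ℝ) * r * log (log (n N)) ≤ c * r * ((1 + ε) * log N) := by gcongr
      _ = c * (1 + ε) * (r * log N) := by ring
      _ ≤ exp (eulerMascheroniConstant - 2 * ε) *
            (((∏ p ∈ S, (1 - 1 / (p : ℝ))) * ∏ p ∈ S, ρ p) * log N) := by gcongr
      _ = exp (-ε) * (∏ p ∈ S, ρ p) * (exp (eulerMascheroniConstant - ε) * log N *
            ∏ p ∈ S, (1 - 1 / (p : ℝ))) := by
          rw [show eulerMascheroniConstant - 2 * ε = -ε + (eulerMascheroniConstant - ε) by ring,
            exp_add]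
          ring
      _ ≤ exp (-ε) * (∏ p ∈ S, ρ p) :=
          mul_le_of_le_one_right (mul_nonneg (exp_pos _).le hρS) hmertens
      _ ≤ f (n N) := hfn
  rw [← ENNReal.coe_mul, ← ENNReal.ofReal_coe_nnreal]
  exact ENNReal.ofReal_le_ofReal (by simpa using hmain)
end

section
/- Let f be a nonnegative multiplicative arithmetic function. If for every prime p, sup_{ν≥0} f(p^ν) ≤ (1 - 1/p)^{-1}, and for every prime p there exists an exponent e_p ∈ ℕ with e_p = p^{o(1)} and f(p^{e_p}) ≥ 1 + 1/p, then limsup_{n→∞} f(n)/log log n = e^γ · ∏_p (1 - 1/p)·sup_{ν≥0} f(p^ν). -/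
open Filter Real

/-- The weight `-log (1 - 1/p)` at primes `p`, zero elsewhere. -/
noncomputable def primeLogWeight (n : ℕ) : ℝ :=
  if n.Prime then -Real.log (1 - 1 / (n : ℝ)) else 0

lemma primeLogWeight_of_prime {p : ℕ} (hp : p.Prime) :
    primeLogWeight p = -Real.log (1 - 1 / (p : ℝ)) := if_pos hp

lemma primeLogWeight_of_not_prime {n : ℕ} (hn : ¬ n.Prime) : primeLogWeight n = 0 := if_neg hn

lemma Nat.Prime.two_le_cast {p : ℕ} (hp : p.Prime) : (2 : ℝ) ≤ p := by exact_mod_cast hp.two_le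

lemma Nat.Prime.one_sub_one_div_pos {p : ℕ} (hp : p.Prime) : 0 < 1 - 1 / (p : ℝ) := by
  have h2 := hp.two_le_cast
  rw [sub_pos, div_lt_one (by linarith)]
  linarith

lemma one_div_le_primeLogWeight {p : ℕ} (hp : p.Prime) : 1 / (p : ℝ) ≤ primeLogWeight p := by
  have h := hp.one_sub_one_div_pos
  rw [primeLogWeight_of_prime hp]
  linarith [Real.log_le_sub_one_of_pos h]

lemma primeLogWeight_le {p : ℕ} (hp : p.Prime) : primeLogWeight p ≤ 1 / ((p : ℝ) - 1) := by
  have h2 := hp.two_le_cast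
  have h := hp.one_sub_one_div_pos
  rw [primeLogWeight_of_prime hp]
  have := Real.one_sub_inv_le_log_of_pos h
  have h3 : (1 - 1 / (p : ℝ))⁻¹ - 1 = 1 / ((p : ℝ) - 1) := by
    have : (p : ℝ) - 1 ≠ 0 := by linarith
    field_simp
    ring
  linarith

lemma one_div_sub_one_le {x : ℝ} (hx : 2 ≤ x) : 1 / (x - 1) ≤ 1 / x + 2 / x ^ 2 := by
  have h1 : 0 < x - 1 := by linarith
  have h0 : 0 < x := by linarith
  have : 1 / x + 2 / x ^ 2 - 1 / (x - 1) = (x - 2) / (x ^ 2 * (x - 1)) := by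
    field_simp
    ring
  have h3 : 0 ≤ (x - 2) / (x ^ 2 * (x - 1)) := div_nonneg (by linarith) (by positivity)
  linarith

lemma primeLogWeight_nonneg (n : ℕ) : 0 ≤ primeLogWeight n := by
  by_cases hn : n.Prime
  · exact le_trans (by positivity) (one_div_le_primeLogWeight hn)
  · rw [primeLogWeight_of_not_prime hn]

lemma sum_range_primeLogWeight_mul (N : ℕ) (g : ℕ → ℝ) :
    ∑ n ∈ Finset.range (N + 1), primeLogWeight n * g n =
      ∑ p ∈ N.primesLE, primeLogWeight p * g p := by
  rw [Nat.primesLE_eq_filter_range, Finset.sum_filter]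
  refine Finset.sum_congr rfl fun n _ => ?_
  split_ifs with h
  · rfl
  · rw [primeLogWeight_of_not_prime h, zero_mul]

lemma log_factorial_eq_sum (N : ℕ) :
    Real.log (N.factorial : ℝ) =
      ∑ p ∈ N.primesLE, (N.factorial.factorization p : ℝ) * Real.log p := by
  have h : (N.factorial : ℝ) = ∏ p ∈ N.primesLE, (p : ℝ) ^ N.factorial.factorization p := by
    conv_lhs => rw [← Nat.prod_factorization_pow_eq_self N.factorial_ne_zero]
    rw [Finsupp.prod, Nat.support_factorization]
    push_cast
    refine Finset.prod_subset ?_ ?_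
    · intro p hp
      have hp' := Nat.prime_of_mem_primeFactors hp
      exact Nat.mem_primesLE.2 ⟨hp'.dvd_factorial.1 (Nat.dvd_of_mem_primeFactors hp), hp'⟩
    · intro p _ hp
      rw [← Nat.support_factorization, Finsupp.notMem_support_iff] at hp
      rw [hp, pow_zero]
  rw [h, Real.log_prod]
  · exact Finset.sum_congr rfl fun p _ => Real.log_pow _ _
  · intro p hp
    have := (Nat.prime_of_mem_primesLE hp).pos
    positivity

lemma summable_log_div_sq : Summable fun n : ℕ => Real.log n / (n : ℝ) ^ 2 := by
  have h : Summable fun n : ℕ => 2 * (1 / (n : ℝ) ^ (3 / 2 : ℝ)) :=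
    (Real.summable_one_div_nat_rpow.2 (by norm_num)).mul_left 2
  refine Summable.of_nonneg_of_le (fun n => ?_) (fun n => ?_) h
  · exact div_nonneg (Real.log_natCast_nonneg n) (by positivity)
  · rcases n.eq_zero_or_pos with rfl | hn
    · norm_num
    have hn' : (0 : ℝ) < n := by exact_mod_cast hn
    have h1 := Real.log_le_rpow_div hn'.le (show (0 : ℝ) < 1 / 2 by norm_num)
    have h2 : (n : ℝ) ^ 2 = (n : ℝ) ^ (1 / 2 : ℝ) * (n : ℝ) ^ (3 / 2 : ℝ) := by
      rw [← Real.rpow_add hn']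
      norm_num
    rw [h2, div_le_iff₀ (by positivity)]
    calc Real.log n ≤ (n : ℝ) ^ (1 / 2 : ℝ) / (1 / 2) := h1
      _ = _ := by field_simp

/-- The upper half of Mertens' first theorem. -/
lemma sum_log_div_le (N : ℕ) :
    ∑ p ∈ N.primesLE, Real.log p / p ≤ Real.log N + Real.log 4 := by
  rcases N.eq_zero_or_pos with rfl | hN
  · simp only [Nat.primesLE_zero, Finset.sum_empty, CharP.cast_eq_zero, Real.log_zero]
    have := Real.log_nonneg (show (1 : ℝ) ≤ 4 by norm_num)
    linarith
  have hN' : (0 : ℝ) < N := by exact_mod_cast hN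
  have h1 : Real.log (N.factorial : ℝ) ≤ N * Real.log N := by
    rw [← Real.log_pow]
    exact Real.log_le_log (by positivity) (by exact_mod_cast N.factorial_le_pow)
  have h2 : Chebyshev.theta N ≤ Real.log 4 * N := Chebyshev.theta_le_log4_mul_x hN'.le
  rw [Chebyshev.theta_eq_sum_primesLE_log] at h2
  have h3 : N * ∑ p ∈ N.primesLE, Real.log p / p - ∑ p ∈ N.primesLE, Real.log p ≤
      Real.log (N.factorial : ℝ) := by
    rw [log_factorial_eq_sum, Finset.mul_sum, ← Finset.sum_sub_distrib]
    refine Finset.sum_le_sum fun p hp => ?_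
    have hpp := Nat.prime_of_mem_primesLE hp
    have hv : (N : ℝ) / p - 1 ≤ N.factorial.factorization p := by
      have h4 : N / p ≤ N.factorial.factorization p := by
        rw [← hpp.pow_dvd_iff_le_factorization N.factorial_ne_zero]
        have h6 : p * (N / p) ≤ N := Nat.mul_div_le N p
        have h7 : p ^ (N / p) ∣ (p * (N / p)).factorial := by
          have : (N / p).factorial * p ^ (N / p) ∣ (p * (N / p)).factorial := by
            rw [mul_comm p]
            generalize N / p = k
            induction k with
            | zero => simp
            | succ k ih =>
              have hq : ((k + 1) * p).factorial =
                  ((k + 1) * p) * ((k + 1) * p - 1).factorial :=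
                (Nat.mul_factorial_pred (by have := hpp.pos; positivity)).symm
              rw [hq, Nat.factorial_succ, pow_succ]
              have hle : k * p ≤ (k + 1) * p - 1 := by
                have := hpp.pos
                rw [Nat.add_mul, one_mul]; omega
              have := ih.trans (Nat.factorial_dvd_factorial hle)
              calc (k + 1) * k.factorial * (p ^ k * p) =
                  ((k + 1) * p) * (k.factorial * p ^ k) := by ring
                _ ∣ _ := mul_dvd_mul_left _ this
          exact (Dvd.intro_left _ rfl).trans this
        exact h7.trans (Nat.factorial_dvd_factorial h6)
      have h5 : (N : ℝ) / p < (N / p : ℕ) + 1 := by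
        rw [← Nat.floor_div_eq_div (K := ℝ)]
        exact Nat.lt_floor_add_one _
      have : ((N / p : ℕ) : ℝ) ≤ N.factorial.factorization p := by exact_mod_cast h4
      linarith
    have hl : 0 ≤ Real.log p := Real.log_natCast_nonneg p
    calc (N : ℝ) * (Real.log p / p) - Real.log p = (N / p - 1) * Real.log p := by ring
      _ ≤ _ := mul_le_mul_of_nonneg_right hv hl
  have h8 : N * ∑ p ∈ N.primesLE, Real.log p / p ≤ N * (Real.log N + Real.log 4) := by
    linarith
  exact le_of_mul_le_mul_left h8 hN'

lemma log_sub_one_le_sum (N : ℕ) :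
    Real.log N - 1 ≤ ∑ p ∈ N.primesLE, Real.log p / ((p : ℝ) - 1) := by
  rcases N.eq_zero_or_pos with rfl | hN
  · simp
  have hN' : (0 : ℝ) < N := by exact_mod_cast hN
  have h1 : N * Real.log N - N ≤ Real.log (N.factorial : ℝ) := by
    have h := Real.pow_div_factorial_le_exp (N : ℝ) hN'.le N
    have h' := Real.log_le_log (by positivity) h
    rw [Real.log_exp, Real.log_div (by positivity) (by positivity), Real.log_pow] at h'
    linarith
  have h2 : Real.log (N.factorial : ℝ) ≤
      N * ∑ p ∈ N.primesLE, Real.log p / ((p : ℝ) - 1) := by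
    rw [log_factorial_eq_sum, Finset.mul_sum]
    refine Finset.sum_le_sum fun p hp => ?_
    have hpp := Nat.prime_of_mem_primesLE hp
    have h2 := hpp.two_le_cast
    have hv : (N.factorial.factorization p : ℝ) ≤ N / ((p : ℝ) - 1) := by
      rw [le_div_iff₀ (by linarith), mul_comm]
      have h4 : (p - 1) * N.factorial.factorization p ≤ N := by
        rw [Nat.sub_one_mul_factorization_factorial hpp]
        exact Nat.sub_le _ _
      have h5 : (((p - 1 : ℕ) : ℝ)) * N.factorial.factorization p ≤ N := by exact_mod_cast h4
      rwa [Nat.cast_sub hpp.one_le, Nat.cast_one] at h5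
    have hl : 0 ≤ Real.log p := Real.log_natCast_nonneg p
    calc _ ≤ N / ((p : ℝ) - 1) * Real.log p := mul_le_mul_of_nonneg_right hv hl
      _ = _ := by ring
  have h3 : N * (Real.log N - 1) ≤ N * ∑ p ∈ N.primesLE, Real.log p / ((p : ℝ) - 1) := by
    linarith
  exact le_of_mul_le_mul_left h3 hN'

/-- Mertens' first theorem, for the weights `-log (1 - 1/p)`. -/
lemma exists_abs_sum_primeLogWeight_mul_log_sub_le :
    ∃ C : ℝ, ∀ N : ℕ, |∑ n ∈ Finset.range (N + 1), primeLogWeight n * Real.log n -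
      Real.log ((N : ℝ) + 1)| ≤ C := by
  refine ⟨1 + Real.log 4 + 2 * ∑' n : ℕ, Real.log n / (n : ℝ) ^ 2, fun N => ?_⟩
  rw [sum_range_primeLogWeight_mul]
  have hT := sum_log_div_le N
  have hQ := log_sub_one_le_sum N
  have h1 : ∑ p ∈ N.primesLE, Real.log p / p ≤
      ∑ p ∈ N.primesLE, primeLogWeight p * Real.log p := by
    refine Finset.sum_le_sum fun p hp => ?_
    rw [div_eq_mul_one_div, mul_comm]
    exact mul_le_mul_of_nonneg_right
      (one_div_le_primeLogWeight (Nat.prime_of_mem_primesLE hp)) (Real.log_natCast_nonneg p)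
  have h2 : ∑ p ∈ N.primesLE, primeLogWeight p * Real.log p ≤
      ∑ p ∈ N.primesLE, Real.log p / ((p : ℝ) - 1) := by
    refine Finset.sum_le_sum fun p hp => ?_
    rw [div_eq_mul_one_div (Real.log _), mul_comm (Real.log _)]
    exact mul_le_mul_of_nonneg_right
      (primeLogWeight_le (Nat.prime_of_mem_primesLE hp)) (Real.log_natCast_nonneg p)
  have h3 : ∑ p ∈ N.primesLE, Real.log p / ((p : ℝ) - 1) ≤
      ∑ p ∈ N.primesLE, Real.log p / p + 2 * ∑' n : ℕ, Real.log n / (n : ℝ) ^ 2 := by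
    have h4 : ∑ p ∈ N.primesLE, Real.log p / (p : ℝ) ^ 2 ≤
        ∑' n : ℕ, Real.log n / (n : ℝ) ^ 2 :=
      summable_log_div_sq.sum_le_tsum _
        fun n _ => div_nonneg (Real.log_natCast_nonneg n) (by positivity)
    have h5 : ∑ p ∈ N.primesLE, Real.log p / ((p : ℝ) - 1) ≤
        ∑ p ∈ N.primesLE, (Real.log p / p + 2 * (Real.log p / (p : ℝ) ^ 2)) := by
      refine Finset.sum_le_sum fun p hp => ?_
      have := mul_le_mul_of_nonneg_left
        (one_div_sub_one_le (Nat.prime_of_mem_primesLE hp).two_le_cast)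
        (Real.log_natCast_nonneg p)
      calc _ = Real.log p * (1 / ((p : ℝ) - 1)) := by ring
        _ ≤ _ := this
        _ = _ := by ring
    rw [Finset.sum_add_distrib, ← Finset.mul_sum] at h5
    linarith
  have h4 : Real.log ((N : ℝ) + 1) ≤ Real.log N + Real.log 4 := by
    rcases N.eq_zero_or_pos with rfl | hN
    · simpa using Real.log_nonneg (show (1 : ℝ) ≤ 4 by norm_num)
    have hN' : (1 : ℝ) ≤ N := by exact_mod_cast hN
    rw [← Real.log_mul (by positivity) (by norm_num)]
    exact Real.log_le_log (by positivity) (by linarith)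
  have h5 : Real.log N ≤ Real.log ((N : ℝ) + 1) := by
    rcases N.eq_zero_or_pos with rfl | hN
    · simp
    have hN' : (1 : ℝ) ≤ N := by exact_mod_cast hN
    exact Real.log_le_log (by positivity) (by linarith)
  rw [abs_le]
  constructor <;> linarith

lemma rpow_neg_lt_one_of_prime {p : ℕ} (hp : p.Prime) {s : ℝ} (hs : 0 < s) :
    (p : ℝ) ^ (-s) < 1 :=
  Real.rpow_lt_one_of_one_lt_of_neg (by exact_mod_cast hp.one_lt) (by linarith)

/-- The logarithm of the Euler product of the zeta function at real `s > 1`. -/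
lemma hasSum_primes_neg_log_one_sub_rpow {s : ℝ} (hs : 1 < s) :
    HasSum (fun n : ℕ => if n.Prime then -Real.log (1 - (n : ℝ) ^ (-s)) else 0)
      (Real.log (∑' n : ℕ, 1 / (n : ℝ) ^ s)) := by
  let F : ℕ →*₀ ℝ :=
    { toFun := fun n => (n : ℝ) ^ (-s)
      map_zero' := by
        simp only [Nat.cast_zero]
        exact Real.zero_rpow (by linarith)
      map_one' := by simp
      map_mul' := fun m n => by
        push_cast
        exact Real.mul_rpow (by positivity) (by positivity) }
  have hF : ∀ n : ℕ, F n = (n : ℝ) ^ (-s) := fun _ => rfl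
  have hF' : ∀ n : ℕ, F n = 1 / (n : ℝ) ^ s := fun n => by
    rw [hF, Real.rpow_neg (by positivity), one_div]
  have hsum : Summable F := by
    refine (Real.summable_one_div_nat_rpow.2 hs).congr fun n => (hF' n).symm
  have hnn : ∀ n, 0 ≤ F n := fun n => by rw [hF]; positivity
  have hnorm : Summable (‖F ·‖) := hsum.norm
  have hprod := EulerProduct.eulerProduct_completely_multiplicative_hasProd hnorm
  have hpos : 0 < ∑' n : ℕ, F n :=
    hsum.tsum_pos hnn 1 (by rw [hF]; simp)
  have hlt : ∀ p : Nat.Primes, 0 < 1 - F p := fun p => by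
    rw [hF, sub_pos]
    exact rpow_neg_lt_one_of_prime p.2 (by linarith)
  have hlog : HasSum (fun p : Nat.Primes => -Real.log (1 - F p)) (Real.log (∑' n : ℕ, F n)) := by
    have h := (Real.continuousAt_log hpos.ne').tendsto.comp hprod
    refine h.congr fun t => ?_
    simp only [Function.comp_apply]
    rw [Real.log_prod fun p _ => (inv_pos.2 (hlt p)).ne']
    exact Finset.sum_congr rfl fun p _ => Real.log_inv _
  have hlog' : HasSum ((fun n : ℕ => -Real.log (1 - (n : ℝ) ^ (-s))) ∘
      ((↑) : {p : ℕ | p.Prime} → ℕ)) (Real.log (∑' n : ℕ, 1 / (n : ℝ) ^ s)) := by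
    rw [← tsum_congr hF']
    exact hlog
  rw [hasSum_subtype_iff_indicator] at hlog'
  refine hlog'.congr_fun ?_
  intro n
  simp [Set.indicator_apply]

/-- For `ε → 0⁺`, `∑ w(n) n^{-ε} + log ε → 0`. -/
lemma tendsto_tsum_primeLogWeight_rpow_add_log :
    (∀ ε : ℝ, 0 < ε → Summable fun n : ℕ => primeLogWeight n * (n : ℝ) ^ (-ε)) ∧
    Tendsto (fun ε : ℝ => ∑' n : ℕ, primeLogWeight n * (n : ℝ) ^ (-ε) + Real.log ε)
      (nhdsWithin 0 (Set.Ioi 0)) (nhds 0) := by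
  let G : ℝ → ℕ → ℝ := fun ε n =>
    if n.Prime then -Real.log (1 - (n : ℝ) ^ (-(1 + ε))) else 0
  let D : ℝ → ℕ → ℝ := fun ε n => primeLogWeight n * (n : ℝ) ^ (-ε) - G ε n
  let bound : ℕ → ℝ := fun n => 2 * (1 / (n : ℝ) ^ 2)
  have hbound : Summable bound := (Real.summable_one_div_nat_pow.2 (by norm_num)).mul_left 2
  have hD : ∀ ε : ℝ, 0 < ε → ∀ n, ‖D ε n‖ ≤ bound n := by
    intro ε hε n
    by_cases hn : n.Prime
    · have h2 := hn.two_le_cast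
      have hp0 : (0 : ℝ) < n := by linarith
      set x : ℝ := (n : ℝ) ^ (-ε) with hx
      have hx0 : 0 < x := by positivity
      have hx1 : x < 1 := rpow_neg_lt_one_of_prime hn hε
      have hsplit : (n : ℝ) ^ (-(1 + ε)) = x * (1 / n) := by
        rw [neg_add, Real.rpow_add hp0, Real.rpow_neg_one, hx]
        ring
      have hy0 : 0 < 1 / (n : ℝ) := by positivity
      have hy1 : 1 / (n : ℝ) < 1 := by rw [div_lt_one hp0]; linarith
      have hxy : x * (1 / n) < 1 := by nlinarith
      have hDe : D ε n = x * primeLogWeight n + Real.log (1 - x * (1 / n)) := by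
        simp only [D, G, if_pos hn, hsplit]
        ring
      have hup : Real.log (1 - x * (1 / n)) ≤ - (x * (1 / n)) := by
        linarith [Real.log_le_sub_one_of_pos (show 0 < 1 - x * (1 / (n : ℝ)) by linarith)]
      have hlow : x * Real.log (1 - 1 / n) ≤ Real.log (1 - x * (1 / n)) := by
        have hc := strictConcaveOn_log_Ioi.concaveOn.2 (x := 1 - 1 / (n : ℝ)) (y := 1)
          (by simpa using hy1) (by simp) hx0.le (show 0 ≤ 1 - x by linarith) (by ring)
        simp only [smul_eq_mul, Real.log_one, mul_zero, add_zero] at hc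
        have he : x * (1 - 1 / (n : ℝ)) + (1 - x) * 1 = 1 - x * (1 / n) := by ring
        rwa [he] at hc
      have hw := primeLogWeight_le hn
      have hw' := one_div_sub_one_le h2
      have hw1 := one_div_le_primeLogWeight hn
      rw [Real.norm_eq_abs, hDe, abs_of_nonneg]
      · have h4 : primeLogWeight n - 1 / n ≤ 2 * (1 / (n : ℝ) ^ 2) := by
          have : 2 * (1 / (n : ℝ) ^ 2) = 2 / (n : ℝ) ^ 2 := by ring
          linarith
        have h5 : x * (primeLogWeight n - 1 / n) ≤ 1 * (primeLogWeight n - 1 / n) :=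
          mul_le_mul_of_nonneg_right hx1.le (by linarith)
        simp only [bound]
        nlinarith
      · rw [primeLogWeight_of_prime hn]
        linarith
    · simp only [D, G, if_neg hn, primeLogWeight_of_not_prime hn, bound]
      simp
  have hsumD : ∀ ε : ℝ, 0 < ε → Summable (D ε) := fun ε hε =>
    Summable.of_norm_bounded hbound (hD ε hε)
  have hG : ∀ ε : ℝ, 0 < ε → HasSum (G ε) (Real.log (∑' n : ℕ, 1 / (n : ℝ) ^ (1 + ε))) :=
    fun ε hε => hasSum_primes_neg_log_one_sub_rpow (by linarith)
  have hsumW : ∀ ε : ℝ, 0 < ε → Summable fun n : ℕ => primeLogWeight n * (n : ℝ) ^ (-ε) :=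
    fun ε hε => ((hsumD ε hε).add (hG ε hε).summable).congr fun n => by simp only [D]; ring
  refine ⟨hsumW, ?_⟩
  have hlim : Tendsto (fun ε => ∑' n, D ε n) (nhdsWithin 0 (Set.Ioi 0))
      (nhds (∑' n : ℕ, (0 : ℝ))) := by
    refine tendsto_tsum_of_dominated_convergence hbound (fun n => ?_) ?_
    · by_cases hn : n.Prime
      · have h2 := hn.two_le_cast
        have hp0 : (0 : ℝ) < n := by linarith
        have hy1 : 1 / (n : ℝ) < 1 := by rw [div_lt_one hp0]; linarith
        have hcont : ContinuousAt (fun ε : ℝ => primeLogWeight n * (n : ℝ) ^ (-ε) -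
            -Real.log (1 - (n : ℝ) ^ (-(1 + ε)))) 0 := by
          have h1 : ContinuousAt (fun ε : ℝ => (n : ℝ) ^ (-ε)) 0 :=
            ContinuousAt.rpow continuousAt_const (by fun_prop) (Or.inl hp0.ne')
          have h3 : ContinuousAt (fun ε : ℝ => (n : ℝ) ^ (-(1 + ε))) 0 :=
            ContinuousAt.rpow continuousAt_const (by fun_prop) (Or.inl hp0.ne')
          have h4 : ContinuousAt (fun ε : ℝ => Real.log (1 - (n : ℝ) ^ (-(1 + ε)))) 0 := by
            refine ContinuousAt.log (continuousAt_const.sub h3) ?_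
            have := rpow_neg_lt_one_of_prime hn (show (0 : ℝ) < 1 + 0 by norm_num)
            linarith
          exact (continuousAt_const.mul h1).sub h4.neg
        have h := hcont.tendsto.mono_left (nhdsWithin_le_nhds (s := Set.Ioi 0))
        have h0 : primeLogWeight n * (n : ℝ) ^ (-(0 : ℝ)) -
            -Real.log (1 - (n : ℝ) ^ (-(1 + (0 : ℝ)))) = 0 := by
          rw [primeLogWeight_of_prime hn, add_zero, Real.rpow_neg_one]
          simp
        rw [h0] at h
        simpa only [D, G, if_pos hn] using h
      · simp only [D, G, if_neg hn, primeLogWeight_of_not_prime hn]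
        simp
    · filter_upwards [self_mem_nhdsWithin] with ε hε using hD ε hε
  rw [tsum_zero] at hlim
  have hz : Tendsto (fun ε : ℝ => Real.log (ε * ∑' n : ℕ, 1 / (n : ℝ) ^ (1 + ε)))
      (nhdsWithin 0 (Set.Ioi 0)) (nhds 0) := by
    have h1 : Tendsto (fun ε : ℝ => 1 + ε) (nhdsWithin 0 (Set.Ioi 0))
        (nhdsWithin 1 (Set.Ioi 1)) := by
      refine tendsto_nhdsWithin_iff.2 ⟨?_, ?_⟩
      · have : ContinuousAt (fun ε : ℝ => 1 + ε) 0 := by fun_prop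
        have h := this.tendsto.mono_left (nhdsWithin_le_nhds (s := Set.Ioi 0))
        simpa using h
      · filter_upwards [self_mem_nhdsWithin] with ε hε
        simpa using hε
    have h2 := tendsto_sub_mul_tsum_nat_rpow.comp h1
    have h3 := (Real.continuousAt_log one_ne_zero).tendsto.comp h2
    rw [Real.log_one] at h3
    refine h3.congr fun ε => ?_
    simp
  have h := hlim.add hz
  rw [add_zero] at h
  refine h.congr' ?_
  filter_upwards [self_mem_nhdsWithin] with ε hε
  have hε' : (0 : ℝ) < ε := hε
  have hpos : 0 < ∑' n : ℕ, 1 / (n : ℝ) ^ (1 + ε) :=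
    (Real.summable_one_div_nat_rpow.2 (by linarith)).tsum_pos (fun n => by positivity) 1 (by simp)
  have h1 : ∑' n, D ε n = ∑' n : ℕ, primeLogWeight n * (n : ℝ) ^ (-ε) -
      Real.log (∑' n : ℕ, 1 / (n : ℝ) ^ (1 + ε)) := by
    simp only [D]
    rw [(hsumW ε hε').tsum_sub (hG ε hε').summable, (hG ε hε').tsum_eq]
  rw [h1, Real.log_mul hε'.ne' hpos.ne']
  ring

/-- The sum of `-log (1 - 1/p)` over the primes of the dyadic block `[2^m, 2^(m+1))`. -/
noncomputable def dyadicPrimeLogWeight (m : ℕ) : ℝ :=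
  ∑ n ∈ Finset.Ico (2 ^ m) (2 ^ (m + 1)), primeLogWeight n

lemma sum_range_dyadic (h : ℕ → ℝ) (h0 : h 0 = 0) (M : ℕ) :
    ∑ m ∈ Finset.range M, ∑ n ∈ Finset.Ico (2 ^ m) (2 ^ (m + 1)), h n =
      ∑ n ∈ Finset.range (2 ^ M), h n := by
  induction M with
  | zero => simp [h0]
  | succ M ih =>
    rw [Finset.sum_range_succ, ih, Finset.sum_range_add_sum_Ico]
    exact Nat.pow_le_pow_right (by norm_num) (Nat.le_succ M)

lemma primeLogWeight_zero : primeLogWeight 0 = 0 := primeLogWeight_of_not_prime Nat.not_prime_zero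

lemma dyadicPrimeLogWeight_nonneg (m : ℕ) : 0 ≤ dyadicPrimeLogWeight m :=
  Finset.sum_nonneg fun n _ => primeLogWeight_nonneg n

lemma log_bounds_of_mem_dyadic {m n : ℕ} (hn : n ∈ Finset.Ico (2 ^ m) (2 ^ (m + 1))) :
    m * Real.log 2 ≤ Real.log n ∧ Real.log n ≤ (m + 1) * Real.log 2 := by
  rw [Finset.mem_Ico] at hn
  have h1 : ((2 : ℝ) ^ m) ≤ n := by exact_mod_cast hn.1
  have h2 : (n : ℝ) ≤ (2 : ℝ) ^ (m + 1) := by exact_mod_cast hn.2.le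
  have hpos : (0 : ℝ) < n := lt_of_lt_of_le (by positivity) h1
  constructor
  · rw [← Real.log_pow]
    exact Real.log_le_log (by positivity) h1
  · have := Real.log_le_log hpos h2
    rw [Real.log_pow] at this
    exact_mod_cast this

lemma exists_tendsto_sum_dyadic_sub :
    (∃ K : ℝ, ∀ m, dyadicPrimeLogWeight m ≤ K) ∧
    ∃ L : ℝ, Tendsto (fun M : ℕ => ∑ m ∈ Finset.range M,
      (dyadicPrimeLogWeight m - 1 / ((m : ℝ) + 1))) atTop (nhds L) := by
  obtain ⟨C, hC⟩ := exists_abs_sum_primeLogWeight_mul_log_sub_le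
  have hl2 : 0 < Real.log 2 := Real.log_pos (by norm_num)
  let a := dyadicPrimeLogWeight
  let t : ℕ → ℝ := fun m => ∑ n ∈ Finset.Ico (2 ^ m) (2 ^ (m + 1)), primeLogWeight n * Real.log n
  have hT : ∀ M : ℕ, |∑ m ∈ Finset.range M, t m - M * Real.log 2| ≤ C := by
    intro M
    have h := hC (2 ^ M - 1)
    have h1 : 2 ^ M - 1 + 1 = 2 ^ M := Nat.sub_add_cancel Nat.one_le_two_pow
    have h2 : (((2 ^ M - 1 : ℕ) : ℝ) + 1) = 2 ^ M := by exact_mod_cast h1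
    rw [h1, h2, Real.log_pow] at h
    simp only [t]
    rwa [sum_range_dyadic _ (by simp)]
  have ht_le : ∀ m, t m ≤ 2 * C + Real.log 2 := by
    intro m
    have h1 := abs_le.1 (hT m)
    have h2 := abs_le.1 (hT (m + 1))
    rw [Finset.sum_range_succ] at h2
    push_cast at h2
    linarith [h1.1, h2.2]
  have hlow : ∀ m : ℕ, m * Real.log 2 * a m ≤ t m := by
    intro m
    simp only [a, dyadicPrimeLogWeight, t]
    rw [Finset.mul_sum]
    refine Finset.sum_le_sum fun n hn => ?_
    rw [mul_comm]
    exact mul_le_mul_of_nonneg_left (log_bounds_of_mem_dyadic hn).1 (primeLogWeight_nonneg n)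
  have hup : ∀ m : ℕ, t m ≤ (m + 1) * Real.log 2 * a m := by
    intro m
    simp only [a, dyadicPrimeLogWeight, t]
    rw [Finset.mul_sum]
    refine Finset.sum_le_sum fun n hn => ?_
    rw [mul_comm]
    exact mul_le_mul_of_nonneg_right (log_bounds_of_mem_dyadic hn).2 (primeLogWeight_nonneg n)
  have ha0 : a 0 = 0 := by
    simp only [a, dyadicPrimeLogWeight]
    refine Finset.sum_eq_zero fun n hn => primeLogWeight_of_not_prime fun hp => ?_
    have := hp.two_le
    rw [Finset.mem_Ico] at hn
    omega
  have hann : ∀ m, 0 ≤ a m := dyadicPrimeLogWeight_nonneg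
  have hC0 : 0 ≤ C := (abs_nonneg _).trans (hT 0)
  set B : ℝ := 2 * (2 * C + Real.log 2) / Real.log 2 with hB
  have hB0 : 0 ≤ B := by positivity
  have haB : ∀ m : ℕ, ((m : ℝ) + 1) * a m ≤ B := by
    intro m
    rcases m.eq_zero_or_pos with rfl | hm
    · rw [ha0, mul_zero]; exact hB0
    · have hm' : (1 : ℝ) ≤ m := by exact_mod_cast hm
      rw [hB, le_div_iff₀ hl2]
      have h1 := hlow m
      have h2 := ht_le m
      have h3 : 0 ≤ Real.log 2 * a m := mul_nonneg hl2.le (hann m)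
      nlinarith
  have haK : ∀ m, a m ≤ B := by
    intro m
    have := haB m
    have hm : (0 : ℝ) ≤ m := by positivity
    nlinarith [hann m]
  refine ⟨⟨B, haK⟩, ?_⟩
  let δ : ℕ → ℝ := fun m => a m - 1 / ((m : ℝ) + 1) * (t m / Real.log 2)
  have hδ0 : ∀ m, 0 ≤ δ m := by
    intro m
    have h1 : 1 / ((m : ℝ) + 1) * (t m / Real.log 2) = t m / (((m : ℝ) + 1) * Real.log 2) := by
      field_simp
    simp only [δ]
    rw [h1, sub_nonneg, div_le_iff₀ (by positivity)]
    linarith [hup m]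
  have hδle : ∀ m : ℕ, δ m ≤ B * (1 / ((m + 1 : ℕ) : ℝ) ^ 2) := by
    intro m
    have h1 : δ m ≤ a m / ((m : ℝ) + 1) := by
      simp only [δ]
      have h2 : a m / ((m : ℝ) + 1) - (a m - 1 / ((m : ℝ) + 1) * (t m / Real.log 2)) =
        (t m - m * Real.log 2 * a m) / (((m : ℝ) + 1) * Real.log 2) := by
        field_simp
        ring
      have h3 : 0 ≤ (t m - m * Real.log 2 * a m) / (((m : ℝ) + 1) * Real.log 2) :=
        div_nonneg (sub_nonneg.2 (hlow m)) (by positivity)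
      linarith
    refine h1.trans ?_
    push_cast
    rw [mul_one_div, div_le_div_iff₀ (by positivity) (by positivity)]
    have hm : (0 : ℝ) ≤ (m : ℝ) + 1 := by positivity
    nlinarith [mul_le_mul_of_nonneg_right (haB m) hm]
  have hδsum : Summable δ := by
    refine Summable.of_nonneg_of_le hδ0 hδle ?_
    exact ((summable_nat_add_iff 1).2
      (Real.summable_one_div_nat_pow.2 (one_lt_two))).mul_left B
  have hdir : CauchySeq fun M : ℕ => ∑ m ∈ Finset.range M,
      (1 / ((m : ℝ) + 1)) • (t m / Real.log 2 - 1) := by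
    refine Antitone.cauchySeq_series_mul_of_tendsto_zero_of_bounded (b := C / Real.log 2)
      ?_ tendsto_one_div_add_atTop_nhds_zero_nat ?_
    · intro m n hmn
      have : (m : ℝ) ≤ n := by exact_mod_cast hmn
      exact one_div_le_one_div_of_le (by positivity) (by linarith)
    · intro M
      have h1 : ∑ i ∈ Finset.range M, (t i / Real.log 2 - 1) =
          (∑ i ∈ Finset.range M, t i - M * Real.log 2) / Real.log 2 := by
        rw [Finset.sum_sub_distrib, ← Finset.sum_div]
        simp
        field_simp
      rw [h1, Real.norm_eq_abs, abs_div, abs_of_pos hl2]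
      exact div_le_div_of_nonneg_right (hT M) hl2.le
  obtain ⟨L', hL'⟩ := cauchySeq_tendsto_of_complete hdir
  refine ⟨_, (hδsum.hasSum.tendsto_sum_nat.add hL').congr fun M => ?_⟩
  rw [← Finset.sum_add_distrib]
  refine Finset.sum_congr rfl fun m _ => ?_
  simp only [δ, smul_eq_mul, a]
  ring

lemma tsum_rpow_dyadic_bounds {ε : ℝ} (hε : 0 < ε) :
    (2 : ℝ) ^ (-ε) * ∑' m : ℕ, dyadicPrimeLogWeight m * ((2 : ℝ) ^ (-ε)) ^ m ≤
      ∑' n : ℕ, primeLogWeight n * (n : ℝ) ^ (-ε) ∧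
    ∑' n : ℕ, primeLogWeight n * (n : ℝ) ^ (-ε) ≤
      ∑' m : ℕ, dyadicPrimeLogWeight m * ((2 : ℝ) ^ (-ε)) ^ m ∧
    Summable fun m : ℕ => dyadicPrimeLogWeight m * ((2 : ℝ) ^ (-ε)) ^ m := by
  obtain ⟨⟨K, hK⟩, -⟩ := exists_tendsto_sum_dyadic_sub
  set r : ℝ := (2 : ℝ) ^ (-ε) with hr
  have hr0 : 0 < r := by positivity
  have hr1 : r < 1 := Real.rpow_lt_one_of_one_lt_of_neg (by norm_num) (by linarith)
  have hsum : Summable fun m : ℕ => dyadicPrimeLogWeight m * r ^ m := by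
    refine Summable.of_nonneg_of_le (fun m => mul_nonneg (dyadicPrimeLogWeight_nonneg m)
      (by positivity)) (fun m => mul_le_mul_of_nonneg_right (hK m) (by positivity)) ?_
    exact (summable_geometric_of_lt_one hr0.le hr1).mul_left K
  have hF := (tendsto_tsum_primeLogWeight_rpow_add_log.1 ε hε).hasSum.tendsto_sum_nat.comp
    (tendsto_pow_atTop_atTop_of_one_lt (one_lt_two (α := ℕ)))
  have hG := hsum.hasSum.tendsto_sum_nat
  have hrpow : ∀ m n : ℕ, n ∈ Finset.Ico (2 ^ m) (2 ^ (m + 1)) →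
      r ^ (m + 1) ≤ (n : ℝ) ^ (-ε) ∧ (n : ℝ) ^ (-ε) ≤ r ^ m := by
    intro m n hn
    have hpow : ∀ k : ℕ, r ^ k = ((2 : ℝ) ^ k) ^ (-ε) := fun k => by
      rw [hr, ← Real.rpow_natCast, ← Real.rpow_natCast, ← Real.rpow_mul (by norm_num),
        ← Real.rpow_mul (by norm_num), mul_comm]
    rw [Finset.mem_Ico] at hn
    have h1 : ((2 : ℝ) ^ m) ≤ n := by exact_mod_cast hn.1
    have h2 : (n : ℝ) ≤ (2 : ℝ) ^ (m + 1) := by exact_mod_cast hn.2.le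
    have hpos : (0 : ℝ) < n := lt_of_lt_of_le (by positivity) h1
    rw [hpow, hpow]
    exact ⟨Real.rpow_le_rpow_of_nonpos hpos h2 (by linarith),
      Real.rpow_le_rpow_of_nonpos (by positivity) h1 (by linarith)⟩
  refine ⟨?_, ?_, hsum⟩
  · refine le_of_tendsto_of_tendsto' (hG.const_mul r) hF fun M => ?_
    simp only [Function.comp_apply]
    rw [← sum_range_dyadic _ (by simp [primeLogWeight_zero]), Finset.mul_sum]
    refine Finset.sum_le_sum fun m _ => ?_
    have : r * (dyadicPrimeLogWeight m * r ^ m) = dyadicPrimeLogWeight m * r ^ (m + 1) := by ring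
    rw [this, dyadicPrimeLogWeight, Finset.sum_mul]
    exact Finset.sum_le_sum fun n hn =>
      mul_le_mul_of_nonneg_left (hrpow m n hn).1 (primeLogWeight_nonneg n)
  · refine le_of_tendsto_of_tendsto' hF hG fun M => ?_
    simp only [Function.comp_apply]
    rw [← sum_range_dyadic _ (by simp [primeLogWeight_zero])]
    refine Finset.sum_le_sum fun m _ => ?_
    rw [dyadicPrimeLogWeight, Finset.sum_mul]
    exact Finset.sum_le_sum fun n hn =>
      mul_le_mul_of_nonneg_left (hrpow m n hn).2 (primeLogWeight_nonneg n)

/-- `(1 - 2^{-ε}) / ε → log 2`. -/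
lemma tendsto_one_sub_two_rpow_div :
    Tendsto (fun ε : ℝ => (1 - (2 : ℝ) ^ (-ε)) / ε) (nhdsWithin 0 (Set.Ioi 0))
      (nhds (Real.log 2)) := by
  have h : HasDerivAt (fun ε : ℝ => 1 - (2 : ℝ) ^ (-ε)) (Real.log 2) 0 := by
    have h1 := (((hasDerivAt_id (0 : ℝ)).neg).const_rpow (a := 2) (by norm_num)).const_sub 1
    simpa using h1
  have h2 := hasDerivAt_iff_tendsto_slope.1 h
  have h3 := h2.mono_left (nhdsWithin_mono 0 (show Set.Ioi (0 : ℝ) ⊆ {0}ᶜ from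
    fun x hx => (ne_of_gt hx)))
  refine h3.congr fun ε => ?_
  simp [slope_def_field]

lemma tendsto_sum_dyadic_sub :
    Tendsto (fun M : ℕ => ∑ m ∈ Finset.range M,
      (dyadicPrimeLogWeight m - 1 / ((m : ℝ) + 1))) atTop (nhds (Real.log (Real.log 2))) := by
  obtain ⟨-, L, hL⟩ := exists_tendsto_sum_dyadic_sub
  suffices L = Real.log (Real.log 2) by rwa [← this]
  have hl2 : 0 < Real.log 2 := Real.log_pos (by norm_num)
  let r : ℝ → ℝ := fun ε => (2 : ℝ) ^ (-ε)
  let F : ℝ → ℝ := fun ε => ∑' n : ℕ, primeLogWeight n * (n : ℝ) ^ (-ε)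
  let G : ℝ → ℝ := fun ε => ∑' m : ℕ, dyadicPrimeLogWeight m * (r ε) ^ m
  have hr : Tendsto r (nhdsWithin 0 (Set.Ioi 0)) (nhdsWithin 1 (Set.Iio 1)) := by
    refine tendsto_nhdsWithin_iff.2 ⟨?_, ?_⟩
    · have h1 : ContinuousAt (fun ε : ℝ => (2 : ℝ) ^ (-ε)) 0 :=
        ContinuousAt.rpow continuousAt_const (by fun_prop) (Or.inl (by norm_num))
      have h := h1.tendsto.mono_left (nhdsWithin_le_nhds (s := Set.Ioi 0))
      simpa using h
    · filter_upwards [self_mem_nhdsWithin] with ε hε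
      have hε' : (0 : ℝ) < ε := hε
      exact Real.rpow_lt_one_of_one_lt_of_neg (by norm_num) (by linarith)
  have hr1 : Tendsto r (nhdsWithin 0 (Set.Ioi 0)) (nhds 1) := hr.mono_right nhdsWithin_le_nhds
  have hA := (Real.tendsto_tsum_powerSeries_nhdsWithin_lt hL).comp hr
  have hB : Tendsto (fun ε => r ε * G ε + Real.log (1 - r ε)) (nhdsWithin 0 (Set.Ioi 0))
      (nhds L) := by
    have h := hr1.mul hA
    rw [one_mul] at h
    refine h.congr' ?_
    filter_upwards [self_mem_nhdsWithin] with ε hε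
    have hε' : (0 : ℝ) < ε := hε
    have hr0 : 0 < r ε := by simp only [r]; positivity
    have hrlt : r ε < 1 := Real.rpow_lt_one_of_one_lt_of_neg (by norm_num) (by linarith)
    have hlog := Real.hasSum_pow_div_log_of_abs_lt_one (x := r ε) (by rwa [abs_of_pos hr0])
    have hlog' : HasSum (fun m : ℕ => r ε * (1 / ((m : ℝ) + 1) * r ε ^ m))
        (-Real.log (1 - r ε)) := by
      refine hlog.congr_fun fun m => ?_
      ring
    have hG := ((tsum_rpow_dyadic_bounds hε').2.2.hasSum).mul_left (r ε)
    have h2 := (hG.sub hlog').tsum_eq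
    simp only [Function.comp_apply]
    rw [← tsum_mul_left]
    have h3 : ∀ m : ℕ, r ε * ((dyadicPrimeLogWeight m - 1 / ((m : ℝ) + 1)) * r ε ^ m) =
        r ε * (dyadicPrimeLogWeight m * ((2 : ℝ) ^ (-ε)) ^ m) -
          r ε * (1 / ((m : ℝ) + 1) * r ε ^ m) := fun m => by
      simp only [r]; ring
    rw [tsum_congr h3, h2]
    simp only [G, r]
    ring
  have h1r : Tendsto (fun ε => 1 - r ε) (nhdsWithin 0 (Set.Ioi 0)) (nhds 0) := by
    simpa using hr1.const_sub 1
  have h1rlog : Tendsto (fun ε => (1 - r ε) * Real.log (1 - r ε)) (nhdsWithin 0 (Set.Ioi 0))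
      (nhds 0) := by
    have h := (Real.continuous_mul_log.tendsto 0).comp h1r
    simpa [Function.comp_def] using h
  have hdiff : Tendsto (fun ε => (1 - r ε) * (r ε)⁻¹ * (r ε * G ε)) (nhdsWithin 0 (Set.Ioi 0))
      (nhds 0) := by
    have h : Tendsto (fun ε => (r ε)⁻¹ * ((1 - r ε) * (r ε * G ε + Real.log (1 - r ε)) -
        (1 - r ε) * Real.log (1 - r ε))) (nhdsWithin 0 (Set.Ioi 0)) (nhds 0) := by
      simpa using (hr1.inv₀ one_ne_zero).mul ((h1r.mul hB).sub h1rlog)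
    refine h.congr fun ε => ?_
    ring
  have hFG : Tendsto (fun ε => F ε - r ε * G ε) (nhdsWithin 0 (Set.Ioi 0)) (nhds 0) := by
    refine tendsto_of_tendsto_of_tendsto_of_le_of_le' tendsto_const_nhds hdiff ?_ ?_
    · filter_upwards [self_mem_nhdsWithin] with ε hε
      exact sub_nonneg.2 (tsum_rpow_dyadic_bounds hε).1
    · filter_upwards [self_mem_nhdsWithin] with ε hε
      have h := (tsum_rpow_dyadic_bounds hε).2.1
      have hr0 : r ε ≠ 0 := by simp only [r]; positivity
      have h' : F ε ≤ G ε := h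
      have : (1 - r ε) * (r ε)⁻¹ * (r ε * G ε) = G ε - r ε * G ε := by
        field_simp
      rw [this]
      linarith
  have hlog : Tendsto (fun ε => Real.log (1 - r ε) - Real.log ε) (nhdsWithin 0 (Set.Ioi 0))
      (nhds (Real.log (Real.log 2))) := by
    have h := (Real.continuousAt_log hl2.ne').tendsto.comp tendsto_one_sub_two_rpow_div
    refine h.congr' ?_
    filter_upwards [self_mem_nhdsWithin] with ε hε
    have hε' : (0 : ℝ) < ε := hε
    have hrlt : r ε < 1 := Real.rpow_lt_one_of_one_lt_of_neg (by norm_num) (by linarith)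
    exact Real.log_div (sub_pos.2 hrlt).ne' hε'.ne'
  have hfin : Tendsto (fun ε => r ε * G ε + Real.log (1 - r ε)) (nhdsWithin 0 (Set.Ioi 0))
      (nhds (Real.log (Real.log 2))) := by
    have h := (tendsto_tsum_primeLogWeight_rpow_add_log.2.add hlog).sub hFG
    simp only [zero_add, sub_zero] at h
    refine h.congr fun ε => ?_
    simp only [F]
    ring
  exact tendsto_nhds_unique hB hfin

/-- Mertens' third theorem in logarithmic form, along powers of two. -/
lemma tendsto_sum_primeLogWeight_two_pow :
    Tendsto (fun M : ℕ => ∑ n ∈ Finset.range (2 ^ M), primeLogWeight n -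
      Real.log (M * Real.log 2)) atTop (nhds Real.eulerMascheroniConstant) := by
  have h := (tendsto_sum_dyadic_sub.add Real.tendsto_harmonic_sub_log).sub_const
    (Real.log (Real.log 2))
  rw [add_sub_cancel_left] at h
  refine h.congr' ?_
  filter_upwards [eventually_gt_atTop 0] with M hM
  have hl2 : 0 < Real.log 2 := Real.log_pos (by norm_num)
  have hM' : (M : ℝ) ≠ 0 := by exact_mod_cast hM.ne'
  rw [Finset.sum_sub_distrib, Real.log_mul hM' hl2.ne',
    ← sum_range_dyadic _ primeLogWeight_zero]
  have hh : ((harmonic M : ℚ) : ℝ) = ∑ m ∈ Finset.range M, 1 / ((m : ℝ) + 1) := by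
    simp [harmonic]
  rw [hh]
  simp only [dyadicPrimeLogWeight]
  ring

lemma tendsto_log_succ_sub_log :
    Tendsto (fun M : ℕ => Real.log (((M + 1 : ℕ) : ℝ) * Real.log 2) -
      Real.log ((M : ℝ) * Real.log 2)) atTop (nhds 0) := by
  have h : Tendsto (fun M : ℕ => Real.log (1 + 1 / (M : ℝ))) atTop (nhds 0) := by
    have h1 := (tendsto_one_div_atTop_nhds_zero_nat (𝕜 := ℝ)).const_add 1
    have h2 := (Real.continuousAt_log (show (1 + 0 : ℝ) ≠ 0 by norm_num)).tendsto.comp h1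
    simpa [Function.comp_def] using h2
  refine h.congr' ?_
  filter_upwards [eventually_gt_atTop 0] with M hM
  have hl2 : 0 < Real.log 2 := Real.log_pos (by norm_num)
  have hM' : (0 : ℝ) < M := by exact_mod_cast hM
  rw [← Real.log_div (by positivity) (by positivity)]
  congr 1
  push_cast
  field_simp

/-- Mertens' third theorem in logarithmic form. -/
lemma tendsto_sum_primeLogWeight_sub_log_log :
    Tendsto (fun N : ℕ => ∑ n ∈ Finset.range (N + 1), primeLogWeight n -
      Real.log (Real.log N)) atTop (nhds Real.eulerMascheroniConstant) := by
  have hl2 : 0 < Real.log 2 := Real.log_pos (by norm_num)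
  have hlog : Tendsto (Nat.log 2) atTop atTop := by
    refine tendsto_atTop.2 fun b => ?_
    filter_upwards [eventually_ge_atTop (2 ^ b)] with n hn
    exact Nat.le_log_of_pow_le (by norm_num) hn
  have hS := tendsto_sum_primeLogWeight_two_pow
  have hlo : Tendsto (fun N : ℕ => ∑ n ∈ Finset.range (2 ^ Nat.log 2 N), primeLogWeight n -
      Real.log (((Nat.log 2 N + 1 : ℕ) : ℝ) * Real.log 2)) atTop
      (nhds Real.eulerMascheroniConstant) := by
    have h := (hS.sub tendsto_log_succ_sub_log).comp hlog
    rw [sub_zero] at h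
    refine h.congr fun N => ?_
    simp only [Function.comp_apply]
    ring
  have hhi : Tendsto (fun N : ℕ => ∑ n ∈ Finset.range (2 ^ (Nat.log 2 N + 1)), primeLogWeight n -
      Real.log ((Nat.log 2 N : ℝ) * Real.log 2)) atTop
      (nhds Real.eulerMascheroniConstant) := by
    have h := ((hS.comp (tendsto_add_atTop_nat 1)).add tendsto_log_succ_sub_log).comp hlog
    rw [add_zero] at h
    refine h.congr fun N => ?_
    simp only [Function.comp_apply]
    ring
  have hmono : ∀ {a b : ℕ}, a ≤ b → ∑ n ∈ Finset.range a, primeLogWeight n ≤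
      ∑ n ∈ Finset.range b, primeLogWeight n := fun hab =>
    Finset.sum_le_sum_of_subset_of_nonneg (Finset.range_mono hab)
      fun n _ _ => primeLogWeight_nonneg n
  refine tendsto_of_tendsto_of_tendsto_of_le_of_le' hlo hhi ?_ ?_
  · filter_upwards [eventually_ge_atTop 2] with N hN
    have h1 : 2 ^ Nat.log 2 N ≤ N := Nat.pow_log_le_self 2 (by omega)
    have h2 : N < 2 ^ (Nat.log 2 N + 1) := Nat.lt_pow_succ_log_self (by norm_num) N
    have hm := (log_bounds_of_mem_dyadic (Finset.mem_Ico.2 ⟨h1, h2⟩)).2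
    have hN1 : (1 : ℝ) < N := by exact_mod_cast hN
    have := Real.log_le_log (Real.log_pos hN1) hm
    push_cast
    linarith [hmono (h1.trans (Nat.le_succ N))]
  · filter_upwards [eventually_ge_atTop 2] with N hN
    have h1 : 2 ^ Nat.log 2 N ≤ N := Nat.pow_log_le_self 2 (by omega)
    have h2 : N < 2 ^ (Nat.log 2 N + 1) := Nat.lt_pow_succ_log_self (by norm_num) N
    have hm := (log_bounds_of_mem_dyadic (Finset.mem_Ico.2 ⟨h1, h2⟩)).1
    have hpos : (0 : ℝ) < Nat.log 2 N := by exact_mod_cast Nat.log_pos (by norm_num) hN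
    have := Real.log_le_log (by positivity) hm
    linarith [hmono (Nat.succ_le_of_lt h2)]

lemma tendsto_prod_primesLE {g : ℕ → ℝ} {a : ℝ} (h : HasProd (fun p : Nat.Primes => g p) a) :
    Tendsto (fun N : ℕ => ∏ p ∈ N.primesLE, g p) atTop (nhds a) := by
  have h1 : HasProd (g ∘ ((↑) : {p : ℕ | p.Prime} → ℕ)) a := h
  rw [hasProd_subtype_iff_mulIndicator] at h1
  refine (h1.tendsto_prod_nat.comp (tendsto_add_atTop_nat 1)).congr fun N => ?_
  simp only [Function.comp_apply]
  rw [Nat.primesLE_eq_filter_range, Finset.prod_filter]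
  exact Finset.prod_congr rfl fun n _ => by simp [Set.mulIndicator_apply]

/-- Mertens' third theorem. -/
lemma tendsto_prod_primesLE_inv_div_log :
    Tendsto (fun N : ℕ => (∏ p ∈ N.primesLE, (1 - 1 / (p : ℝ))⁻¹) / Real.log N) atTop
      (nhds (Real.exp Real.eulerMascheroniConstant)) := by
  have h := (Real.continuous_exp.tendsto _).comp tendsto_sum_primeLogWeight_sub_log_log
  refine h.congr' ?_
  filter_upwards [eventually_ge_atTop 2] with N hN
  have hN1 : (1 : ℝ) < N := by exact_mod_cast hN
  simp only [Function.comp_apply]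
  rw [Real.exp_sub, Real.exp_log (Real.log_pos hN1)]
  congr 1
  have h1 := sum_range_primeLogWeight_mul N fun _ => 1
  simp only [mul_one] at h1
  rw [h1, Real.exp_sum]
  refine Finset.prod_congr rfl fun p hp => ?_
  have hpp := Nat.prime_of_mem_primesLE hp
  rw [primeLogWeight_of_prime hpp, Real.exp_neg, Real.exp_log hpp.one_sub_one_div_pos]

lemma exists_hasProd_and_tendsto {ρ : ℕ → ℝ}
    (hlow : ∀ p : ℕ, p.Prime → 1 + 1 / (p : ℝ) ≤ ρ p)
    (hup : ∀ p : ℕ, p.Prime → ρ p ≤ (1 - 1 / (p : ℝ))⁻¹) :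
    ∃ R : ℝ, 0 < R ∧ HasProd (fun p : Nat.Primes => (1 - 1 / ((p : ℕ) : ℝ)) * ρ p) R ∧
      Tendsto (fun N : ℕ => (∏ p ∈ N.primesLE, ρ p) / Real.log N) atTop
        (nhds (Real.exp Real.eulerMascheroniConstant * R)) := by
  have hglow : ∀ p : ℕ, p.Prime → 1 - 1 / (p : ℝ) ^ 2 ≤ (1 - 1 / (p : ℝ)) * ρ p := by
    intro p hp
    calc 1 - 1 / (p : ℝ) ^ 2 = (1 - 1 / (p : ℝ)) * (1 + 1 / (p : ℝ)) := by ring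
      _ ≤ _ := mul_le_mul_of_nonneg_left (hlow p hp) hp.one_sub_one_div_pos.le
  have hsq : ∀ p : ℕ, p.Prime → 1 / (p : ℝ) ^ 2 ≤ 1 / 2 := by
    intro p hp
    have h2 := hp.two_le_cast
    exact one_div_le_one_div_of_le (by norm_num) (by nlinarith)
  have hgpos : ∀ p : ℕ, p.Prime → 0 < (1 - 1 / (p : ℝ)) * ρ p := fun p hp => by
    linarith [hglow p hp, hsq p hp]
  have hgle : ∀ p : ℕ, p.Prime → (1 - 1 / (p : ℝ)) * ρ p ≤ 1 := fun p hp => by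
    have h := mul_le_mul_of_nonneg_left (hup p hp) hp.one_sub_one_div_pos.le
    rwa [mul_inv_cancel₀ hp.one_sub_one_div_pos.ne'] at h
  have hsum : Summable fun p : Nat.Primes => Real.log ((1 - 1 / ((p : ℕ) : ℝ)) * ρ p) := by
    have hb : Summable fun p : Nat.Primes => 2 * (1 / ((p : ℕ) : ℝ) ^ 2) :=
      ((Real.summable_one_div_nat_pow.2 one_lt_two).mul_left 2).comp_injective
        (i := ((↑) : Nat.Primes → ℕ)) Subtype.coe_injective
    refine Summable.of_norm_bounded hb fun p => ?_
    set x : ℝ := 1 / ((p : ℕ) : ℝ) ^ 2 with hx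
    have h1 := hglow p p.2
    have h2 := hsq p p.2
    have hx0 : 0 ≤ x := by positivity
    rw [Real.norm_eq_abs, abs_of_nonpos (Real.log_nonpos (hgpos p p.2).le (hgle p p.2))]
    have h3 := Real.log_le_log (show 0 < 1 - x by linarith) h1
    have h4 := Real.one_sub_inv_le_log_of_pos (show 0 < 1 - x by linarith)
    have h5 : (1 - x)⁻¹ ≤ 1 + 2 * x := by
      rw [inv_le_iff_one_le_mul₀ (by linarith)]
      nlinarith
    linarith
  have hprod := Real.hasProd_of_hasSum_log (f := fun p : Nat.Primes =>
    (1 - 1 / ((p : ℕ) : ℝ)) * ρ p) (fun p => hgpos p p.2) hsum.hasSum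
  refine ⟨_, Real.exp_pos _, hprod, ?_⟩
  refine (tendsto_prod_primesLE_inv_div_log.mul
    (tendsto_prod_primesLE (g := fun p => (1 - 1 / (p : ℝ)) * ρ p) hprod)).congr fun N => ?_
  rw [div_mul_eq_mul_div, ← Finset.prod_mul_distrib]
  congr 1
  refine Finset.prod_congr rfl fun p hp => ?_
  rw [inv_mul_cancel_left₀ (Nat.prime_of_mem_primesLE hp).one_sub_one_div_pos.ne']

/-- The contribution of the prime factors of `n` exceeding `log n`. -/
lemma prod_large_primeFactors_le_s3 {ρ : ℕ → ℝ}
    (hlow : ∀ p : ℕ, p.Prime → 1 + 1 / (p : ℝ) ≤ ρ p)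
    (hup : ∀ p : ℕ, p.Prime → ρ p ≤ (1 - 1 / (p : ℝ))⁻¹)
    {n y : ℕ} (hn : n ≠ 0) (hy : 2 ≤ y) (hny : Real.log n < y + 1) :
    ∏ p ∈ n.primeFactors with ¬ p ≤ y, ρ p ≤
      Real.exp (((y : ℝ) + 1) / (y * Real.log (y + 1))) := by
  set s := n.primeFactors.filter fun p => ¬ p ≤ y with hs
  have hy' : (2 : ℝ) ≤ y := by exact_mod_cast hy
  have hl : 0 < Real.log ((y : ℝ) + 1) := Real.log_pos (by linarith)
  have hmem : ∀ p ∈ s, p.Prime ∧ ((y : ℝ) + 1) ≤ p := by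
    intro p hp
    rw [hs, Finset.mem_filter] at hp
    refine ⟨Nat.prime_of_mem_primeFactors hp.1, ?_⟩
    exact_mod_cast not_le.1 hp.2
  have hcard : (s.card : ℝ) * Real.log (y + 1) ≤ Real.log n := by
    rw [← Real.log_pow]
    refine Real.log_le_log (by positivity) ?_
    have h1 : ((y : ℝ) + 1) ^ s.card ≤ ∏ p ∈ s, (p : ℝ) := by
      rw [← Finset.prod_const]
      exact Finset.prod_le_prod (fun _ _ => by positivity) fun p hp => (hmem p hp).2
    have h2 : ∏ p ∈ s, p ≤ n := by
      refine Nat.le_of_dvd (Nat.pos_of_ne_zero hn) ?_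
      exact (Finset.prod_dvd_prod_of_subset _ _ _ (Finset.filter_subset _ _)).trans
        (Nat.prod_primeFactors_dvd n)
    refine h1.trans ?_
    rw [← Nat.cast_prod]
    exact Nat.cast_le.2 h2
  have hterm : ∀ p ∈ s, ρ p ≤ Real.exp (1 / (y : ℝ)) := by
    intro p hp
    obtain ⟨hpp, hyp⟩ := hmem p hp
    refine (hup p hpp).trans ?_
    have h1 : (1 - 1 / (p : ℝ))⁻¹ = 1 / ((p : ℝ) - 1) + 1 := by
      have : (p : ℝ) - 1 ≠ 0 := by linarith
      have : (p : ℝ) ≠ 0 := by linarith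
      field_simp
      ring
    rw [h1]
    have h2 : 1 / ((p : ℝ) - 1) ≤ 1 / y := one_div_le_one_div_of_le (by linarith) (by linarith)
    linarith [Real.add_one_le_exp (1 / (y : ℝ))]
  calc ∏ p ∈ s, ρ p ≤ ∏ _p ∈ s, Real.exp (1 / (y : ℝ)) :=
        Finset.prod_le_prod (fun p hp => le_trans (by positivity) (hlow p (hmem p hp).1)) hterm
    _ = Real.exp (s.card * (1 / (y : ℝ))) := by
        rw [Finset.prod_const, ← Real.exp_nat_mul]
    _ ≤ _ := by
        rw [Real.exp_le_exp, mul_one_div, div_le_div_iff₀ (by linarith) (by positivity)]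
        nlinarith

/-- The upper bound: `f n / log log n` is eventually dominated by a convergent sequence. -/
lemma exists_tendsto_and_eventually_le
    (f : ℕ → ℝ) (hf0 : ∀ n, 0 ≤ f n) (hf1 : f 1 = 1)
    (hfm : ∀ m n : ℕ, Nat.Coprime m n → f (m * n) = f m * f n)
    {ρ : ℕ → ℝ} (hfρ : ∀ p : ℕ, p.Prime → ∀ ν, f (p ^ ν) ≤ ρ p)
    (hlow : ∀ p : ℕ, p.Prime → 1 + 1 / (p : ℝ) ≤ ρ p)
    (hup : ∀ p : ℕ, p.Prime → ρ p ≤ (1 - 1 / (p : ℝ))⁻¹) {A : ℝ}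
    (hA : Tendsto (fun N : ℕ => (∏ p ∈ N.primesLE, ρ p) / Real.log N) atTop (nhds A)) :
    ∃ U : ℕ → ℝ, Tendsto U atTop (nhds A) ∧
      ∀ᶠ n in atTop, f n / Real.log (Real.log n) ≤ U n := by
  let V : ℕ → ℝ := fun y => (∏ p ∈ y.primesLE, ρ p) / Real.log y *
    Real.exp (((y : ℝ) + 1) / (y * Real.log (y + 1)))
  have hV : Tendsto V atTop (nhds A) := by
    have h1 : Tendsto (fun y : ℕ => (1 + 1 / (y : ℝ)) * (Real.log ((y : ℝ) + 1))⁻¹) atTop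
        (nhds 0) := by
      have h2 := (tendsto_one_div_atTop_nhds_zero_nat (𝕜 := ℝ)).const_add 1
      have h3 : Tendsto (fun y : ℕ => (Real.log ((y : ℝ) + 1))⁻¹) atTop (nhds 0) :=
        tendsto_inv_atTop_zero.comp (Real.tendsto_log_atTop.comp
          (tendsto_atTop_add_const_right _ 1 tendsto_natCast_atTop_atTop))
      simpa using h2.mul h3
    have h4 := hA.mul ((Real.continuous_exp.tendsto 0).comp h1)
    rw [Real.exp_zero, mul_one] at h4
    refine h4.congr' ?_
    filter_upwards [eventually_gt_atTop 0] with y hy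
    have hy' : (y : ℝ) ≠ 0 := by exact_mod_cast hy.ne'
    simp only [V, Function.comp_apply]
    congr 2
    rw [div_mul_eq_div_div, div_eq_mul_inv _ (Real.log _)]
    congr 1
    field_simp
  have hlogt : Tendsto (fun n : ℕ => Real.log n) atTop atTop :=
    Real.tendsto_log_atTop.comp tendsto_natCast_atTop_atTop
  have hfl : Tendsto (fun n : ℕ => ⌊Real.log n⌋₊) atTop atTop :=
    tendsto_nat_floor_atTop.comp hlogt
  refine ⟨fun n => V ⌊Real.log n⌋₊, hV.comp hfl, ?_⟩
  filter_upwards [eventually_gt_atTop 0, hfl.eventually_ge_atTop 2] with n hn hy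
  set y := ⌊Real.log n⌋₊ with hydef
  have hy' : (2 : ℝ) ≤ y := by exact_mod_cast hy
  have hyn : (y : ℝ) ≤ Real.log n := Nat.floor_le (Real.log_natCast_nonneg n)
  have hρ1 : ∀ p : ℕ, p.Prime → 1 ≤ ρ p := fun p hp => by
    have : (0 : ℝ) ≤ 1 / p := by positivity
    linarith [hlow p hp]
  have hf : f n ≤ ∏ p ∈ n.primeFactors, ρ p := by
    rw [Nat.multiplicative_factorization f hfm hf1 hn.ne', Finsupp.prod,
      Nat.support_factorization]
    exact Finset.prod_le_prod (fun p _ => hf0 _) fun p hp =>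
      hfρ p (Nat.prime_of_mem_primeFactors hp) _
  have hsmall : ∏ p ∈ n.primeFactors with p ≤ y, ρ p ≤ ∏ p ∈ y.primesLE, ρ p := by
    refine Finset.prod_le_prod_of_subset_of_one_le ?_ ?_ ?_
    · intro p hp
      rw [Finset.mem_filter] at hp
      exact Nat.mem_primesLE.2 ⟨hp.2, Nat.prime_of_mem_primeFactors hp.1⟩
    · intro p hp
      rw [Finset.mem_filter] at hp
      exact zero_le_one.trans (hρ1 p (Nat.prime_of_mem_primeFactors hp.1))
    · exact fun p hp _ => hρ1 p (Nat.prime_of_mem_primesLE hp)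
  have hlarge := prod_large_primeFactors_le_s3 hlow hup hn.ne' hy (Nat.lt_floor_add_one (Real.log n))
  have hprodnn : 0 ≤ ∏ p ∈ y.primesLE, ρ p :=
    Finset.prod_nonneg fun p hp => zero_le_one.trans (hρ1 p (Nat.prime_of_mem_primesLE hp))
  have hly : 0 < Real.log y := Real.log_pos (by linarith)
  have hll : Real.log y ≤ Real.log (Real.log n) := Real.log_le_log (by linarith) hyn
  rw [← Finset.prod_filter_mul_prod_filter_not _ (fun p => p ≤ y)] at hf
  have hf' : f n ≤ (∏ p ∈ y.primesLE, ρ p) *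
      Real.exp (((y : ℝ) + 1) / (y * Real.log (y + 1))) := by
    refine hf.trans (mul_le_mul hsmall hlarge ?_ hprodnn)
    refine Finset.prod_nonneg fun p hp => zero_le_one.trans (hρ1 p ?_)
    exact Nat.prime_of_mem_primeFactors (Finset.mem_filter.1 hp).1
  calc f n / Real.log (Real.log n) ≤ f n / Real.log y :=
        div_le_div_of_nonneg_left (hf0 n) hly hll
    _ ≤ _ := div_le_div_of_nonneg_right hf' hly.le
    _ = V y := by simp only [V]; ring

lemma map_prod_primesLE_pow (f : ℕ → ℝ) (hf1 : f 1 = 1)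
    (hfm : ∀ m n : ℕ, Nat.Coprime m n → f (m * n) = f m * f n) (k : ℕ → ℕ) (s : Finset ℕ)
    (hs : ∀ p ∈ s, p.Prime) : f (∏ p ∈ s, p ^ k p) = ∏ p ∈ s, f (p ^ k p) := by
  induction s using Finset.induction_on with
  | empty => simp [hf1]
  | insert a s ha ih =>
    rw [Finset.prod_insert ha, Finset.prod_insert ha, hfm, ih fun p hp =>
      hs p (Finset.mem_insert_of_mem hp)]
    refine Nat.Coprime.prod_right fun p hp => Nat.Coprime.pow _ _ ?_
    rw [Nat.coprime_primes (hs a (Finset.mem_insert_self a s))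
      (hs p (Finset.mem_insert_of_mem hp))]
    rintro rfl
    exact ha hp

/-- If `k p = p^{o(1)}`, then `log log ∏_{p ≤ x} p^{k p} ≤ (1 + ε) log x` for large `x`. -/
lemma eventually_log_log_prod_le {k : ℕ → ℕ}
    (hk : ∀ ε : ℝ, 0 < ε → ∀ᶠ p : ℕ in atTop, p.Prime → (k p : ℝ) ≤ (p : ℝ) ^ ε)
    {ε : ℝ} (hε : 0 < ε) :
    ∀ᶠ x : ℕ in atTop, 1 < Real.log ((∏ p ∈ x.primesLE, p ^ k p : ℕ) : ℝ) →
      Real.log (Real.log ((∏ p ∈ x.primesLE, p ^ k p : ℕ) : ℝ)) ≤ (1 + ε) * Real.log x := by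
  obtain ⟨K, hK⟩ := eventually_atTop.1 (hk (ε / 2) (by linarith))
  set C : ℝ := 1 + ∑ p ∈ Finset.range K, (k p : ℝ) with hC
  have hC1 : 1 ≤ C := by
    have : 0 ≤ ∑ p ∈ Finset.range K, (k p : ℝ) := Finset.sum_nonneg fun _ _ => by positivity
    linarith
  have hl4 : 0 < Real.log 4 := Real.log_pos (by norm_num)
  have hkC : ∀ p : ℕ, p.Prime → (k p : ℝ) ≤ C * (p : ℝ) ^ (ε / 2) := by
    intro p hp
    have h1 : 1 ≤ (p : ℝ) ^ (ε / 2) :=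
      Real.one_le_rpow (by exact_mod_cast hp.one_le) (by linarith)
    rcases le_or_gt K p with h | h
    · have := hK p h hp
      nlinarith
    · have h2 : (k p : ℝ) ≤ ∑ p ∈ Finset.range K, (k p : ℝ) :=
        Finset.single_le_sum (f := fun p => (k p : ℝ)) (fun _ _ => by positivity)
          (Finset.mem_range.2 h)
      nlinarith
  have hlogt : Tendsto (fun n : ℕ => Real.log n) atTop atTop :=
    Real.tendsto_log_atTop.comp tendsto_natCast_atTop_atTop
  filter_upwards [eventually_gt_atTop 0,
    hlogt.eventually_ge_atTop (Real.log (C * Real.log 4) / (ε / 2))] with x hx hxl hgt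
  have hx' : (0 : ℝ) < x := by exact_mod_cast hx
  have hlog : Real.log ((∏ p ∈ x.primesLE, p ^ k p : ℕ) : ℝ) ≤
      C * Real.log 4 * ((x : ℝ) ^ (ε / 2) * x) := by
    push_cast
    rw [Real.log_prod fun p hp => by
      have := (Nat.prime_of_mem_primesLE hp).pos
      positivity]
    have hθ := Chebyshev.theta_le_log4_mul_x hx'.le
    rw [Chebyshev.theta_eq_sum_primesLE_log] at hθ
    calc ∑ p ∈ x.primesLE, Real.log ((p : ℝ) ^ k p)
        ≤ ∑ p ∈ x.primesLE, C * (x : ℝ) ^ (ε / 2) * Real.log p := by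
          refine Finset.sum_le_sum fun p hp => ?_
          rw [Real.log_pow]
          refine mul_le_mul_of_nonneg_right ?_ (Real.log_natCast_nonneg p)
          refine (hkC p (Nat.prime_of_mem_primesLE hp)).trans ?_
          refine mul_le_mul_of_nonneg_left ?_ (by linarith)
          exact Real.rpow_le_rpow (by positivity)
            (by exact_mod_cast Nat.le_of_mem_primesLE hp) (by linarith)
      _ = C * (x : ℝ) ^ (ε / 2) * ∑ p ∈ x.primesLE, Real.log p := by rw [Finset.mul_sum]
      _ ≤ C * (x : ℝ) ^ (ε / 2) * (Real.log 4 * x) :=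
          mul_le_mul_of_nonneg_left hθ (by positivity)
      _ = _ := by ring
  have h1 := Real.log_le_log (by linarith) hlog
  rw [Real.log_mul (by positivity) (by positivity), Real.log_mul (by positivity) hx'.ne',
    Real.log_rpow hx'] at h1
  rw [div_le_iff₀ (by linarith)] at hxl
  linarith

lemma eventually_natCast_le_rpow {e : ℕ → ℕ} (he_pos : ∀ p : ℕ, p.Prime → 0 < e p)
    (he : Tendsto (fun p : ℕ => Real.log (e p) / Real.log p)
      (atTop ⊓ principal {p : ℕ | p.Prime}) (nhds 0)) {ε : ℝ} (hε : 0 < ε) :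
    ∀ᶠ p : ℕ in atTop, p.Prime → (e p : ℝ) ≤ (p : ℝ) ^ ε := by
  filter_upwards [eventually_inf_principal.1 (he.eventually_lt_const hε)] with p hp hpp
  have h2 := hpp.two_le_cast
  have hp0 : (0 : ℝ) < p := by linarith
  have h := hp hpp
  rw [div_lt_iff₀ (Real.log_pos (by linarith))] at h
  rw [← Real.log_le_log_iff (by exact_mod_cast he_pos p hpp) (by positivity), Real.log_rpow hp0]
  exact h.le

lemma tendsto_prod_primesLE_pow_atTop {k : ℕ → ℕ} (hk : ∀ᶠ p in atTop, p.Prime → 0 < k p) :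
    Tendsto (fun x : ℕ => ∏ p ∈ x.primesLE, p ^ k p) atTop atTop := by
  refine tendsto_atTop.2 fun b => ?_
  obtain ⟨K, hK⟩ := eventually_atTop.1 hk
  obtain ⟨q, hq, hqp⟩ := Nat.exists_infinite_primes (max K b)
  filter_upwards [eventually_ge_atTop q] with x hx
  have hpos : 0 < ∏ p ∈ x.primesLE, p ^ k p :=
    Finset.prod_pos fun p hp => pow_pos (Nat.prime_of_mem_primesLE hp).pos _
  have hdvd : q ∣ ∏ p ∈ x.primesLE, p ^ k p :=
    (dvd_pow_self q (hK q ((le_max_left _ _).trans hq) hqp).ne').trans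
      (Finset.dvd_prod_of_mem (fun p => p ^ k p) (Nat.mem_primesLE.2 ⟨hx, hqp⟩))
  exact ((le_max_right _ _).trans hq).trans (Nat.le_of_dvd hpos hdvd)

/-- A lower bound for the limsup along the numbers `∏_{p ≤ x} p^{k p}` with `k p = p^{o(1)}`. -/
lemma le_limsup_div_log_log {f : ℕ → ℝ} (hf0 : ∀ n, 0 ≤ f n)
    (hbdd : IsBoundedUnder (· ≤ ·) atTop fun n : ℕ => f n / Real.log (Real.log n))
    {k : ℕ → ℕ} (hk0 : ∀ᶠ p in atTop, p.Prime → 0 < k p)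
    (hk : ∀ ε : ℝ, 0 < ε → ∀ᶠ p : ℕ in atTop, p.Prime → (k p : ℝ) ≤ (p : ℝ) ^ ε)
    {g : ℕ → ℝ} {B : ℝ} (hg : Tendsto (fun x : ℕ => g x / Real.log x) atTop (nhds B))
    (hfg : ∀ᶠ x : ℕ in atTop, g x ≤ f (∏ p ∈ x.primesLE, p ^ k p)) :
    B ≤ limsup (fun n : ℕ => f n / Real.log (Real.log n)) atTop := by
  set L := limsup (fun n : ℕ => f n / Real.log (Real.log n)) atTop with hL
  have hn := tendsto_prod_primesLE_pow_atTop hk0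
  have hlogn : Tendsto (fun x : ℕ => Real.log ((∏ p ∈ x.primesLE, p ^ k p : ℕ) : ℝ)) atTop atTop :=
    Real.tendsto_log_atTop.comp (tendsto_natCast_atTop_atTop.comp hn)
  have key : ∀ ε : ℝ, 0 < ε → B ≤ (1 + ε) * L := by
    intro ε hε
    rw [← div_le_iff₀' (by linarith)]
    refine le_of_forall_lt fun b hb => ?_
    obtain ⟨c, hbc, hc⟩ := exists_between hb
    refine hbc.trans_le (le_limsup_of_frequently_le ?_ hbdd)
    refine hn.frequently (Eventually.frequently ?_)
    filter_upwards [hfg, eventually_log_log_prod_le hk hε, hlogn.eventually_gt_atTop 1,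
      (hg.div_const (1 + ε)).eventually_const_lt hc, eventually_gt_atTop 1] with x h1 h2 h3 h4 h5
    have hx : 0 < Real.log x := Real.log_pos (by exact_mod_cast h5)
    have hll := Real.log_pos h3
    calc c ≤ g x / Real.log x / (1 + ε) := h4.le
      _ = g x / ((1 + ε) * Real.log x) := by rw [div_div, mul_comm]
      _ ≤ f (∏ p ∈ x.primesLE, p ^ k p) / ((1 + ε) * Real.log x) := by gcongr
      _ ≤ _ := div_le_div_of_nonneg_left (hf0 _) hll (h2 h3)
  have ht : Tendsto (fun ε : ℝ => (1 + ε) * L) (nhdsWithin 0 (Set.Ioi 0)) (nhds L) := by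
    have h : Tendsto (fun ε : ℝ => (1 + ε) * L) (nhds 0) (nhds ((1 + 0) * L)) :=
      (by fun_prop : Continuous fun ε : ℝ => (1 + ε) * L).tendsto 0
    rw [add_zero, one_mul] at h
    exact h.mono_left nhdsWithin_le_nhds
  exact ge_of_tendsto ht (eventually_nhdsWithin_of_forall key)

/-- Choosing near-optimal exponents at the primes up to `K` and the exponents `e p` beyond. -/
lemma prod_div_mul_le_limsup
    {f : ℕ → ℝ} (hf0 : ∀ n, 0 ≤ f n) (hf1 : f 1 = 1)
    (hfm : ∀ m n : ℕ, Nat.Coprime m n → f (m * n) = f m * f n)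
    (hbdd : IsBoundedUnder (· ≤ ·) atTop fun n : ℕ => f n / Real.log (Real.log n))
    {ρ : ℕ → ℝ} (hρ : ∀ p : ℕ, p.Prime → IsLUB (Set.range fun ν : ℕ => f (p ^ ν)) (ρ p))
    {e : ℕ → ℕ} (he_pos : ∀ p : ℕ, p.Prime → 0 < e p)
    (he : Tendsto (fun p : ℕ => Real.log (e p) / Real.log p)
      (atTop ⊓ principal {p : ℕ | p.Prime}) (nhds 0))
    {g : ℕ → ℝ} (hg : ∀ p : ℕ, p.Prime → 0 < g p) (hfe : ∀ p : ℕ, p.Prime → g p ≤ f (p ^ e p))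
    {B : ℝ} (hB : Tendsto (fun x : ℕ => (∏ p ∈ x.primesLE, g p) / Real.log x) atTop (nhds B))
    (K : ℕ) :
    (∏ p ∈ K.primesLE, ρ p / g p) * B ≤
      limsup (fun n : ℕ => f n / Real.log (Real.log n)) atTop := by
  have hρpos : ∀ p : ℕ, p.Prime → 0 < ρ p := fun p hp =>
    (hg p hp).trans_le ((hfe p hp).trans ((hρ p hp).1 ⟨e p, rfl⟩))
  have key : ∀ η ∈ Set.Ioo (0 : ℝ) 1, (∏ p ∈ K.primesLE, (1 - η) * ρ p / g p) * B ≤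
      limsup (fun n : ℕ => f n / Real.log (Real.log n)) atTop := by
    rintro η ⟨hη, hη1⟩
    have hν : ∀ p : ℕ, ∃ ν : ℕ, p.Prime → (1 - η) * ρ p ≤ f (p ^ ν) := by
      intro p
      by_cases hp : p.Prime
      · have h : (1 - η) * ρ p < ρ p := by nlinarith [hρpos p hp]
        obtain ⟨_, ⟨ν, rfl⟩, h1, -⟩ := (hρ p hp).exists_between h
        exact ⟨ν, fun _ => h1.le⟩
      · exact ⟨0, fun h => absurd h hp⟩
    choose ν hν using hν
    let k : ℕ → ℕ := fun p => if p ≤ K then ν p else e p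
    have hke : ∀ᶠ p in atTop, k p = e p := by
      filter_upwards [eventually_gt_atTop K] with p hp
      simp [k, hp.not_ge]
    refine le_limsup_div_log_log hf0 hbdd (k := k)
      (g := fun x => (∏ p ∈ K.primesLE, (1 - η) * ρ p / g p) * ∏ p ∈ x.primesLE, g p) ?_ ?_ ?_ ?_
    · filter_upwards [hke] with p hp
      rw [hp]
      exact he_pos p
    · intro ε hε
      filter_upwards [hke, eventually_natCast_le_rpow he_pos he hε] with p hp
      rw [hp]
      exact id
    · simpa only [mul_div_assoc] using hB.const_mul (∏ p ∈ K.primesLE, (1 - η) * ρ p / g p)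
    · filter_upwards [eventually_ge_atTop K] with x hx
      rw [map_prod_primesLE_pow f hf1 hfm k _ fun p => Nat.prime_of_mem_primesLE]
      have hK : K.primesLE = x.primesLE.filter (· ≤ K) := by
        ext p
        simp only [Finset.mem_filter, Nat.mem_primesLE]
        exact ⟨fun h => ⟨⟨h.1.trans hx, h.2⟩, h.1⟩, fun h => ⟨h.2, h.1.2⟩⟩
      rw [hK, Finset.prod_filter, ← Finset.prod_mul_distrib]
      refine Finset.prod_le_prod (fun p hp => ?_) fun p hp => ?_ <;>
        have hpp := Nat.prime_of_mem_primesLE hp <;>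
        have hgp := hg p hpp
      · have hρp := hρpos p hpp
        have hη' : 0 < 1 - η := sub_pos.2 hη1
        split_ifs <;> positivity
      · by_cases h : p ≤ K
        · simpa only [k, h, if_true, div_mul_cancel₀ _ hgp.ne'] using hν p hpp
        · simpa only [k, h, if_false, one_mul] using hfe p hpp
  have ht : Tendsto (fun η : ℝ => (∏ p ∈ K.primesLE, (1 - η) * ρ p / g p) * B)
      (nhdsWithin 0 (Set.Ioi 0)) (nhds ((∏ p ∈ K.primesLE, ρ p / g p) * B)) := by
    have h : Tendsto (fun η : ℝ => (∏ p ∈ K.primesLE, (1 - η) * ρ p / g p) * B) (nhds 0)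
        (nhds ((∏ p ∈ K.primesLE, (1 - 0) * ρ p / g p) * B)) :=
      (by fun_prop : Continuous fun η : ℝ =>
        (∏ p ∈ K.primesLE, (1 - η) * ρ p / g p) * B).tendsto 0
    simp only [sub_zero, one_mul] at h
    exact h.mono_left nhdsWithin_le_nhds
  exact le_of_tendsto ht (eventually_of_mem (Ioo_mem_nhdsGT one_pos) key)

/-- **Corollary 1 (Tóth–Wirsing).** If `f` is a nonnegative multiplicative function
with `sup_ν f(p^ν) ≤ (1-1/p)⁻¹` for all primes `p`, and for every prime `p` there is
an exponent `e p = p^{o(1)}` with `f(p^{e p}) ≥ 1 + 1/p`, then the maximal order of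
`f(n)` is `e^γ R log log n`, i.e. `limsup f(n)/log log n = e^γ ∏_p (1-1/p) ρ(p)`
(and the product converges). -/
theorem limsup_eq_of_rho_bounds
    (f : ℕ → ℝ) (hf0 : ∀ n, 0 ≤ f n) (hf1 : f 1 = 1)
    (hfm : ∀ m n : ℕ, Nat.Coprime m n → f (m * n) = f m * f n)
    (ρ : ℕ → ℝ)
    (hρ : ∀ p : ℕ, p.Prime → IsLUB (Set.range fun ν : ℕ => f (p ^ ν)) (ρ p))
    (hρle : ∀ p : ℕ, p.Prime → ρ p ≤ (1 - 1 / (p : ℝ))⁻¹)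
    (e : ℕ → ℕ) (he_pos : ∀ p : ℕ, p.Prime → 0 < e p)
    (he : Filter.Tendsto (fun p : ℕ => Real.log (e p) / Real.log p)
      (Filter.atTop ⊓ Filter.principal {p : ℕ | p.Prime}) (nhds 0))
    (hfe : ∀ p : ℕ, p.Prime → 1 + 1 / (p : ℝ) ≤ f (p ^ e p)) :
    Multipliable (fun p : Nat.Primes => (1 - 1 / ((p : ℕ) : ℝ)) * ρ (p : ℕ)) ∧
    Filter.limsup (fun n : ℕ => f n / Real.log (Real.log n)) Filter.atTop =
      Real.exp Real.eulerMascheroniConstant *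
        ∏' p : Nat.Primes, (1 - 1 / ((p : ℕ) : ℝ)) * ρ (p : ℕ) := by
  have hfρ : ∀ p : ℕ, p.Prime → ∀ ν, f (p ^ ν) ≤ ρ p := fun p hp ν => (hρ p hp).1 ⟨ν, rfl⟩
  have hlow : ∀ p : ℕ, p.Prime → 1 + 1 / (p : ℝ) ≤ ρ p := fun p hp =>
    (hfe p hp).trans (hfρ p hp _)
  obtain ⟨R, -, hR, hRt⟩ := exists_hasProd_and_tendsto hlow hρle
  obtain ⟨Z, hZ, -, hZt⟩ := exists_hasProd_and_tendsto (ρ := fun p => 1 + 1 / (p : ℝ))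
    (fun _ _ => le_rfl) fun p hp => (hlow p hp).trans (hρle p hp)
  obtain ⟨U, hU, hfU⟩ := exists_tendsto_and_eventually_le f hf0 hf1 hfm hfρ hlow hρle hRt
  have hbdd : IsBoundedUnder (· ≤ ·) atTop fun n : ℕ => f n / Real.log (Real.log n) :=
    hU.isBoundedUnder_le.mono_le hfU
  have hlogt : Tendsto (fun n : ℕ => Real.log n) atTop atTop :=
    Real.tendsto_log_atTop.comp tendsto_natCast_atTop_atTop
  have hnn : ∀ᶠ n : ℕ in atTop, 0 ≤ f n / Real.log (Real.log n) := by
    filter_upwards [hlogt.eventually_ge_atTop 1] with n hn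
    exact div_nonneg (hf0 n) (Real.log_nonneg hn)
  have hcobdd : IsCoboundedUnder (· ≤ ·) atTop fun n : ℕ => f n / Real.log (Real.log n) :=
    (isBoundedUnder_of_eventually_ge hnn).isCoboundedUnder_le
  refine ⟨hR.multipliable, ?_⟩
  rw [hR.tprod_eq]
  refine le_antisymm ?_ ?_
  · rw [← hU.limsup_eq]
    exact limsup_le_limsup hfU hcobdd hU.isBoundedUnder_le
  · have hEZ : Real.exp Real.eulerMascheroniConstant * Z ≠ 0 := by positivity
    have ht := (hRt.div hZt hEZ).mul_const (Real.exp Real.eulerMascheroniConstant * Z)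
    rw [div_mul_cancel₀ _ hEZ] at ht
    refine le_of_tendsto ht ?_
    filter_upwards [eventually_gt_atTop 1] with K hK
    have hl : Real.log K ≠ 0 := (Real.log_pos (by exact_mod_cast hK)).ne'
    have h := prod_div_mul_le_limsup hf0 hf1 hfm hbdd hρ he_pos he
      (g := fun p => 1 + 1 / (p : ℝ)) (fun p _ => by positivity) hfe hZt K
    rw [Finset.prod_div_distrib] at h
    simpa only [Pi.div_apply, div_div_div_cancel_right₀ hl] using h
end
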